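/- arXiv:2001.02017 — 2 statements merged into one kernel-verified Lean document; each statement's English description precedes it below -/
import Mathlib

section
/- Let N be a stable 3-pair network whose subnetwork N_{t_1,t_2} is non-degenerated, with ℓ(r_i) = ℓ(g_l) = 1, and let j be the index of {1,2,3} distinct from both i and l. Then: (1) g_i(2) ≠ r_l(2); (2) there exists exactly one {g_i, r_j}-l.c.s. and exactly one {g_j, r_l}-l.c.s.; and (3) at least one of the following three statements holds: (a) g_i(2) = r_j(2) and g_j(2) = r_l(2); (b) g_i(2) = r_j(2) and g_j(2) = r_l(3); (c) g_i(3) = r_j(2) and g_j(2) = r_l(2). -/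
open scoped BigOperators

/-- A `k`-pair network: a finite DAG with `k` sources of in-degree 0 and
`k` sinks of out-degree 0. -/
structure KPairNetwork (k : ℕ) where
  V : Type
  A : Type
  [fintypeV : Fintype V]
  [fintypeA : Fintype A]
  [decEqV : DecidableEq V]
  [decEqA : DecidableEq A]
  tail : A → V
  head : A → V
  /-- acyclicity, via a topological ordering of the vertices -/
  acyclic : ∃ ord : V → ℕ, ∀ a : A, ord (tail a) < ord (head a)
  src : Fin k → V
  snk : Fin k → V
  src_inj : Function.Injective src
  snk_inj : Function.Injective snk
  src_no_in : ∀ (i : Fin k) (a : A), head a ≠ src i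
  snk_no_out : ∀ (i : Fin k) (a : A), tail a ≠ snk i

attribute [instance] KPairNetwork.fintypeV KPairNetwork.fintypeA
attribute [instance] KPairNetwork.decEqV KPairNetwork.decEqA

namespace KPairNetwork

variable {k : ℕ} (N : KPairNetwork k)

/-- `l` is (the list of arcs of) a directed path from `u` to `v`. -/
def IsPathFrom (u v : N.V) (l : List N.A) : Prop :=
  l ≠ [] ∧ l.Chain' (fun a b => N.head a = N.tail b) ∧
    (∀ a ∈ l.head?, N.tail a = u) ∧ (∀ a ∈ l.getLast?, N.head a = v)

/-- The vertices lying on a (nonempty) list of arcs. -/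
def pathVerts (l : List N.A) : Set N.V :=
  {v | ∃ a ∈ l, v = N.tail a ∨ v = N.head a}

/-- `P i j` is a path from `s i` to `t j`, and for each sink `j` the `k`
paths `P · j` are pairwise arc-disjoint (strong reachability). -/
def IsStrongSystem (P : Fin k → Fin k → List N.A) : Prop :=
  (∀ i j, N.IsPathFrom (N.src i) (N.snk j) (P i j)) ∧
    ∀ (j i i' : Fin k), i ≠ i' → ∀ a : N.A, a ∈ P i j → a ∉ P i' j

/-- Extra strong reachability: in addition, for each sink `j`, two distinct
paths towards `t j` share no vertex other than `t j`. -/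
def IsExtraStrongSystem (P : Fin k → Fin k → List N.A) : Prop :=
  N.IsStrongSystem P ∧
    ∀ (j i i' : Fin k), i ≠ i' →
      ∀ v : N.V, v ∈ N.pathVerts (P i j) → v ∈ N.pathVerts (P i' j) → v = N.snk j

/-- Stability: the choice of the `k` pairwise arc-disjoint paths towards each
sink is unique. -/
def IsStableSystem (P : Fin k → Fin k → List N.A) : Prop :=
  N.IsStrongSystem P ∧
    ∀ (j : Fin k) (Q : Fin k → List N.A),
      (∀ i, N.IsPathFrom (N.src i) (N.snk j) (Q i)) →
      (∀ i i', i ≠ i' → ∀ a : N.A, a ∈ Q i → a ∉ Q i') →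
      ∀ i, Q i = P i j

/-- `excess_f(v) = Σ_{head a = v} f a − Σ_{tail a = v} f a`. -/
noncomputable def excess (f : N.A → ℝ) (v : N.V) : ℝ :=
  (∑ a : N.A, if N.head a = v then f a else 0) -
    (∑ a : N.A, if N.tail a = v then f a else 0)

/-- An `u`–`v` flow: zero excess away from `u` and `v`. -/
def IsFlow (u v : N.V) (f : N.A → ℝ) : Prop :=
  ∀ w : N.V, w ≠ u → w ≠ v → N.excess f w = 0

/-- The unit flow along a path: `1` on its arcs and `0` elsewhere. -/
noncomputable def unitFlow (l : List N.A) : N.A → ℝ :=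
  fun a => if a ∈ l then 1 else 0

/-- The set of source/sink index pairs whose path passes through the arc `a`. -/
def arcPattern (P : Fin k → Fin k → List N.A) (a : N.A) : Finset (Fin k × Fin k) :=
  Finset.univ.filter (fun q => a ∈ P q.1 q.2)

/-- `S_N`, the family of index-pair patterns of the arcs of `N`. -/
def SN (P : Fin k → Fin k → List N.A) : Set (Finset (Fin k × Fin k)) :=
  {T | ∃ a : N.A, T = N.arcPattern P a}

/-! ### Segments and longest common segments -/

/-- A segment: a start vertex together with a (possibly empty) chained list of
arcs starting there.  A segment with no arcs is a single vertex. -/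
def IsSeg (s : N.V × List N.A) : Prop :=
  s.2.Chain' (fun a b => N.head a = N.tail b) ∧ ∀ a ∈ s.2.head?, N.tail a = s.1

/-- The vertices of a segment. -/
def segVerts (s : N.V × List N.A) : Set N.V :=
  insert s.1 (N.pathVerts s.2)

/-- The final vertex of a segment. -/
def segEnd (s : N.V × List N.A) : N.V :=
  s.2.getLast?.elim s.1 N.head

/-- The segment `s` lies on the path `p`. -/
def SegOn (s : N.V × List N.A) (p : List N.A) : Prop :=
  s.2 <:+: p ∧ s.1 ∈ N.pathVerts p

/-- The segment `s` is contained in the segment `s'`. -/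
def SegLE (s s' : N.V × List N.A) : Prop :=
  s.2 <:+: s'.2 ∧ s.1 ∈ N.segVerts s'

/-- `s` is a longest common segment (l.c.s.) of the set of paths `ps`:
it is a segment common to all paths of `ps`, and no segment properly
containing it is common to all paths of `ps`. -/
def IsLCS (ps : Set (List N.A)) (s : N.V × List N.A) : Prop :=
  N.IsSeg s ∧ (∀ p ∈ ps, N.SegOn s p) ∧
    ∀ s' : N.V × List N.A, N.IsSeg s' → N.SegLE s s' → s' ≠ s →
      ∃ p ∈ ps, ¬ N.SegOn s' p

/-- `s` is an l.c.s. of some pair `{P i j₁, P i' j₂}` and lies on `p`. -/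
def IsPairLCSOn (P : Fin k → Fin k → List N.A) (j₁ j₂ : Fin k)
    (p : List N.A) (s : N.V × List N.A) : Prop :=
  (∃ i i' : Fin k, N.IsLCS {P i j₁, P i' j₂} s) ∧ N.SegOn s p

/-- `ℓ^{j₁,j₂}(p)`: the number of l.c.s.'s of pairs `{P i j₁, P i' j₂}` lying
on the path `p`. -/
noncomputable def lcsCount (P : Fin k → Fin k → List N.A) (j₁ j₂ : Fin k)
    (p : List N.A) : ℕ :=
  Nat.card {s : N.V × List N.A | N.IsPairLCSOn P j₁ j₂ p s}

/-- `m_{j₁,j₂}^c = {i : ℓ^{j₁,j₂}(P_{s_i,t_c}) = 1}`. -/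
def mset (P : Fin k → Fin k → List N.A) (j₁ j₂ c : Fin k) : Set (Fin k) :=
  {i | N.lcsCount P j₁ j₂ (P i c) = 1}

/-- `u` lies strictly before `v` along the path `p` (there is a nonempty
infix of `p` going from `u` to `v`). -/
def StrictlyBeforeOn (p : List N.A) (u v : N.V) : Prop :=
  ∃ l : List N.A, l <:+: p ∧ l.head?.map N.tail = some u ∧ l.getLast?.map N.head = some v

/-- `e 0, …, e (L-1)` enumerates, in the order along `p`, the l.c.s.'s
`p(1) < p(2) < ⋯ < p(L)` of pairs `{P i j₁, P i' j₂}` lying on `p`. -/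
def IsLCSEnum (P : Fin k → Fin k → List N.A) (j₁ j₂ : Fin k) (p : List N.A)
    (e : ℕ → N.V × List N.A) (L : ℕ) : Prop :=
  (∀ n, n < L → N.IsPairLCSOn P j₁ j₂ p (e n)) ∧
  (∀ s, N.IsPairLCSOn P j₁ j₂ p s → ∃ n, n < L ∧ e n = s) ∧
  (∀ m n, m < n → n < L → N.StrictlyBeforeOn p (N.segEnd (e m)) (e n).1)

/-! ### Residual networks, regular cycles, semi-cycles and crossings -/

/-- `a` is a `P_{t_j}`-arc. -/
def isPArc (P : Fin k → Fin k → List N.A) (j : Fin k) (a : N.A) : Prop :=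
  ∃ i, a ∈ P i j

/-- The tail of `a` in the `j`-th residual network `N_j` (in which all
`P_{t_j}`-arcs are reversed). -/
def rtail (P : Fin k → Fin k → List N.A) (j : Fin k) (a : N.A) : N.V :=
  if ∃ i, a ∈ P i j then N.head a else N.tail a

/-- The head of `a` in the `j`-th residual network `N_j`. -/
def rhead (P : Fin k → Fin k → List N.A) (j : Fin k) (a : N.A) : N.V :=
  if ∃ i, a ∈ P i j then N.tail a else N.head a

/-- `l` is a directed cycle of the residual network `N_j`. -/
def IsResidCycle (P : Fin k → Fin k → List N.A) (j : Fin k) (l : List N.A) : Prop :=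
  l ≠ [] ∧ l.Nodup ∧
  l.Chain' (fun a b => N.rhead P j a = N.rtail P j b) ∧
  (∀ a ∈ l.getLast?, ∀ b ∈ l.head?, N.rhead P j a = N.rtail P j b) ∧
  (l.map (N.rtail P j)).Nodup

/-- A regular cycle of `N_j`: a directed cycle of `N_j` having no isolated
vertex of `P_{t_j}`, i.e. every vertex of the cycle lying on a path of
`P_{t_j}` is incident in the cycle to some (reversed) `P_{t_j}`-arc. -/
def IsRegularCycle (P : Fin k → Fin k → List N.A) (j : Fin k) (l : List N.A) : Prop :=
  N.IsResidCycle P j l ∧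
    ∀ v ∈ l.map (N.rtail P j),
      (∃ i, v ∈ N.pathVerts (P i j)) →
      ∃ a ∈ l, N.isPArc P j a ∧ (v = N.tail a ∨ v = N.head a)

/-- A `P_{t_j}`-semi-cycle of `N`: the arc set of a regular cycle of `N_j`,
with the original orientations of `N` restored. -/
def IsSemiCycle (P : Fin k → Fin k → List N.A) (j : Fin k) (E : Set N.A) : Prop :=
  ∃ l : List N.A, N.IsRegularCycle P j l ∧ E = {a | a ∈ l}

/-- A `P_{t_j}`-crossing of `N`: a `P_{t_j}`-semi-cycle with all its
`P_{t_j}`-arcs removed. -/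
def IsCrossing (P : Fin k → Fin k → List N.A) (j : Fin k) (E : Set N.A) : Prop :=
  ∃ l : List N.A, N.IsRegularCycle P j l ∧ E = {a | a ∈ l ∧ ¬ N.isPArc P j a}

end KPairNetwork

namespace KPairNetwork

section Walks

variable {k : ℕ} {N : KPairNetwork k} {u v w u' v' : N.V} {l l₁ l₂ p q : List N.A}

/-- `l` is a possibly empty directed walk from `u` to `v`. -/
def IsWalk (N : KPairNetwork k) : N.V → List N.A → N.V → Prop
  | u, [], v => u = v
  | u, a :: l, v => N.tail a = u ∧ IsWalk N (N.head a) l v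

@[simp] theorem isWalk_nil : N.IsWalk u [] v ↔ u = v := Iff.rfl

@[simp] theorem isWalk_cons {a : N.A} :
    N.IsWalk u (a :: l) v ↔ N.tail a = u ∧ N.IsWalk (N.head a) l v := Iff.rfl

theorem isWalk_append :
    N.IsWalk u (l₁ ++ l₂) v ↔ ∃ w, N.IsWalk u l₁ w ∧ N.IsWalk w l₂ v := by
  induction l₁ generalizing u with
  | nil => simp
  | cons a l ih => simp [ih, and_assoc]

theorem IsWalk.append (h₁ : N.IsWalk u l₁ w) (h₂ : N.IsWalk w l₂ v) :
    N.IsWalk u (l₁ ++ l₂) v := isWalk_append.2 ⟨w, h₁, h₂⟩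

theorem isWalk_iff : N.IsWalk u l v ↔
    l.IsChain (fun a b => N.head a = N.tail b) ∧ (∀ a ∈ l.head?, N.tail a = u) ∧
      l.getLast?.elim u N.head = v := by
  induction l generalizing u with
  | nil => simp
  | cons a l ih =>
    rw [isWalk_cons, ih]
    cases l with
    | nil => simp
    | cons b l =>
      simp only [List.isChain_cons_cons, List.head?_cons, Option.mem_def, Option.some.injEq,
        forall_eq', List.getLast?_cons_cons]
      rw [List.getLast?_eq_getLast_of_ne_nil (List.cons_ne_nil b l)]
      simp only [Option.elim_some]
      grind

theorem isPathFrom_iff : N.IsPathFrom u v l ↔ l ≠ [] ∧ N.IsWalk u l v := by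
  unfold IsPathFrom
  rw [isWalk_iff]
  refine and_congr_right fun hl => and_congr_right fun _ => and_congr_right fun _ => ?_
  rw [List.getLast?_eq_getLast_of_ne_nil hl]
  simp

theorem isSeg_iff {s : N.V × List N.A} : N.IsSeg s ↔ N.IsWalk s.1 s.2 (N.segEnd s) := by
  rw [isWalk_iff]
  simp only [IsSeg, segEnd, and_true]
  rfl

theorem IsWalk.end_unique (h : N.IsWalk u l v) (h' : N.IsWalk u l v') : v = v' := by
  induction l generalizing u with
  | nil => exact h.symm.trans h'
  | cons a l ih => exact ih h.2 h'.2

theorem IsWalk.start_unique (h : N.IsWalk u l v) (h' : N.IsWalk u' l v) : u = u' := by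
  cases l with
  | nil => exact h.trans h'.symm
  | cons a l => exact h.1.symm.trans h'.1

theorem IsWalk.ends_unique (h : N.IsWalk u l v) (h' : N.IsWalk u' l v') (hl : l ≠ []) :
    u = u' ∧ v = v' := by
  cases l with
  | nil => exact absurd rfl hl
  | cons a l => exact ⟨h.1.symm.trans h'.1, h.2.end_unique h'.2⟩

theorem segEnd_eq (h : N.IsWalk u l v) : N.segEnd (u, l) = v := by
  have := (isWalk_iff.1 h).2.2
  simpa [segEnd] using this

theorem IsWalk.isSeg (h : N.IsWalk u l v) : N.IsSeg (u, l) := by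
  rw [isSeg_iff, segEnd_eq h]
  exact h

theorem IsWalk.mem_segVerts (h : N.IsWalk u l v) :
    w ∈ N.segVerts (u, l) ↔ ∃ l₁ l₂, l = l₁ ++ l₂ ∧ N.IsWalk u l₁ w ∧ N.IsWalk w l₂ v := by
  induction l generalizing u with
  | nil =>
    have h : u = v := h
    subst h
    constructor
    · intro hw
      have : w = u := by simpa [segVerts, pathVerts] using hw
      subst this
      exact ⟨[], [], rfl, rfl, rfl⟩
    · rintro ⟨l₁, l₂, e, h₁, h₂⟩
      obtain ⟨rfl, rfl⟩ := List.append_eq_nil_iff.1 e.symm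
      simp [segVerts, show w = u from h₂]
  | cons a l ih =>
    have key : w ∈ N.segVerts (u, a :: l) ↔ w = u ∨ w ∈ N.segVerts (N.head a, l) := by
      have := h.1
      simp only [segVerts, pathVerts, List.mem_cons, exists_eq_or_imp, Set.mem_insert_iff,
        Set.mem_ofPred_eq]
      grind
    rw [key, ih h.2]
    constructor
    · rintro (rfl | ⟨l₁, l₂, rfl, h₁, h₂⟩)
      · exact ⟨[], a :: l, rfl, rfl, h⟩
      · exact ⟨a :: l₁, l₂, rfl, ⟨h.1, h₁⟩, h₂⟩
    · rintro ⟨l₁, l₂, e, h₁, h₂⟩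
      cases l₁ with
      | nil => exact Or.inl (show u = w from h₁).symm
      | cons b l₁ =>
        obtain ⟨rfl, rfl⟩ := List.cons.inj e
        exact Or.inr ⟨l₁, l₂, rfl, h₁.2, h₂⟩

theorem IsWalk.pathVerts_eq (h : N.IsWalk u l v) (hl : l ≠ []) :
    N.pathVerts l = N.segVerts (u, l) := by
  cases l with
  | nil => exact absurd rfl hl
  | cons a l =>
    refine (Set.insert_eq_of_mem ?_).symm
    exact ⟨a, List.mem_cons_self, Or.inl h.1.symm⟩

theorem segVerts_mono {s s' : N.V × List N.A} (h : N.SegLE s s') :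
    N.segVerts s ⊆ N.segVerts s' := by
  rintro x (rfl | ⟨a, ha, hx⟩)
  · exact h.2
  · exact Or.inr ⟨a, h.1.subset ha, hx⟩

theorem IsPathFrom.isWalk (h : N.IsPathFrom u v p) : N.IsWalk u p v := (isPathFrom_iff.1 h).2

theorem IsPathFrom.mem_pathVerts (h : N.IsPathFrom u v p) : w ∈ N.pathVerts p ↔
    ∃ l₁ l₂, p = l₁ ++ l₂ ∧ N.IsWalk u l₁ w ∧ N.IsWalk w l₂ v := by
  rw [h.isWalk.pathVerts_eq h.1, h.isWalk.mem_segVerts]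

theorem IsPathFrom.start_mem (h : N.IsPathFrom u v p) : u ∈ N.pathVerts p :=
  h.mem_pathVerts.2 ⟨[], p, rfl, rfl, h.isWalk⟩

theorem IsPathFrom.segOn_iff {s : N.V × List N.A} (h : N.IsPathFrom u v p) (hs : N.IsSeg s) :
    N.SegOn s p ↔ ∃ L R, p = L ++ s.2 ++ R ∧ N.IsWalk u L s.1 ∧ N.IsWalk (N.segEnd s) R v := by
  have hw := isSeg_iff.1 hs
  constructor
  · rintro ⟨⟨L, R, e⟩, hv⟩
    by_cases h0 : s.2 = []
    · obtain ⟨L, R, e, h₁, h₂⟩ := h.mem_pathVerts.1 hv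
      rw [h0] at hw ⊢
      exact ⟨L, R, by simpa using e, h₁, (show s.1 = N.segEnd s from hw) ▸ h₂⟩
    · have hp := h.isWalk
      rw [← e] at hp
      obtain ⟨y, hy, hR⟩ := isWalk_append.1 hp
      obtain ⟨x, hL, hx⟩ := isWalk_append.1 hy
      obtain ⟨rfl, rfl⟩ := hx.ends_unique hw h0
      exact ⟨L, R, e.symm, hL, hR⟩
  · rintro ⟨L, R, e, hL, hR⟩
    exact ⟨⟨L, R, e.symm⟩, h.mem_pathVerts.2 ⟨L, s.2 ++ R, by simpa using e, hL, hw.append hR⟩⟩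

theorem SegOn.segVerts_subset {s : N.V × List N.A} (h : N.SegOn s p) :
    N.segVerts s ⊆ N.pathVerts p := by
  rintro x (rfl | ⟨a, ha, hx⟩)
  · exact h.2
  · exact ⟨a, h.1.subset ha, hx⟩

end Walks

section Order

variable {k : ℕ} {N : KPairNetwork k} {u v w x y : N.V} {l l₁ l₂ p q : List N.A}
  {ord : N.V → ℕ}

/-- `ord` is a topological ordering of the vertices. -/
def IsTopOrder (N : KPairNetwork k) (ord : N.V → ℕ) : Prop :=
  ∀ a : N.A, ord (N.tail a) < ord (N.head a)

theorem IsWalk.ord_le (ho : N.IsTopOrder ord) (h : N.IsWalk u l v) : ord u ≤ ord v := by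
  induction l generalizing u with
  | nil => exact (congrArg ord (show u = v from h)).le
  | cons a l ih => exact h.1 ▸ (ho a).le.trans (ih h.2)

theorem IsWalk.ord_lt (ho : N.IsTopOrder ord) (h : N.IsWalk u l v) (hl : l ≠ []) :
    ord u < ord v := by
  cases l with
  | nil => exact absurd rfl hl
  | cons a l => exact h.1 ▸ (ho a).trans_le (h.2.ord_le ho)

theorem IsWalk.eq_nil (ho : N.IsTopOrder ord) (h : N.IsWalk u l v) (hv : ord v ≤ ord u) :
    l = [] := by
  by_contra hl
  exact (h.ord_lt ho hl).not_ge hv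

theorem IsWalk.split_unique (ho : N.IsTopOrder ord) {l₁' l₂' : List N.A}
    (h : N.IsWalk u l₁ w) (h' : N.IsWalk u l₁' w) (e : l₁ ++ l₂ = l₁' ++ l₂') :
    l₁ = l₁' ∧ l₂ = l₂' := by
  have key : ∀ {l l' m : List N.A}, N.IsWalk u l w → N.IsWalk u l' w → l' = l ++ m → m = [] := by
    rintro l l' m h h' rfl
    obtain ⟨y, hy, hm⟩ := isWalk_append.1 h'
    obtain rfl := h.end_unique hy
    exact hm.eq_nil ho le_rfl
  rcases List.append_eq_append_iff.1 e with ⟨m, e₁, e₂⟩ | ⟨m, e₁, e₂⟩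
  · obtain rfl := key h h' e₁
    simp_all
  · obtain rfl := key h' h e₁
    simp_all

theorem IsWalk.split_two (ho : N.IsTopOrder ord) (h : N.IsPathFrom u v p)
    (hx : x ∈ N.pathVerts p) (hy : y ∈ N.pathVerts p) (hxy : ord x ≤ ord y) :
    ∃ L M R, p = L ++ M ++ R ∧ N.IsWalk u L x ∧ N.IsWalk x M y ∧ N.IsWalk y R v := by
  obtain ⟨L, R, e, hL, hR⟩ := h.mem_pathVerts.1 hx
  obtain ⟨L', R', e', hL', hR'⟩ := h.mem_pathVerts.1 hy
  rcases List.append_eq_append_iff.1 (e.symm.trans e') with ⟨m, e₁, e₂⟩ | ⟨m, e₁, e₂⟩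
  · subst e₁
    obtain ⟨z, hz, hm⟩ := isWalk_append.1 hL'
    obtain rfl := hL.end_unique hz
    exact ⟨L, m, R', e', hL, hm, hR'⟩
  · subst e₁
    obtain ⟨z, hz, hm⟩ := isWalk_append.1 hL
    obtain rfl := hL'.end_unique hz
    obtain rfl := hm.eq_nil ho hxy
    obtain rfl : y = x := hm
    exact ⟨L', [], R', by simpa using e', hL', rfl, hR'⟩

theorem IsSeg.ord_start_le (ho : N.IsTopOrder ord) {s : N.V × List N.A} (hs : N.IsSeg s)
    (hx : x ∈ N.segVerts s) : ord s.1 ≤ ord x := by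
  obtain ⟨_, _, _, h, _⟩ := (isSeg_iff.1 hs).mem_segVerts.1 hx
  exact h.ord_le ho

theorem IsSeg.ord_le_end (ho : N.IsTopOrder ord) {s : N.V × List N.A} (hs : N.IsSeg s)
    (hx : x ∈ N.segVerts s) : ord x ≤ ord (N.segEnd s) := by
  obtain ⟨_, _, _, _, h⟩ := (isSeg_iff.1 hs).mem_segVerts.1 hx
  exact h.ord_le ho

theorem IsSeg.end_mem {s : N.V × List N.A} (hs : N.IsSeg s) : N.segEnd s ∈ N.segVerts s :=
  (isSeg_iff.1 hs).mem_segVerts.2 ⟨s.2, [], by simp, isSeg_iff.1 hs, rfl⟩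

theorem start_mem (s : N.V × List N.A) : s.1 ∈ N.segVerts s := Set.mem_insert _ _

/-- A vertex of a path lying between the end points of a segment of it lies on the segment. -/
theorem SegOn.mem_of_between (ho : N.IsTopOrder ord) {s : N.V × List N.A}
    (h : N.IsPathFrom u v p) (hs : N.IsSeg s) (hsp : N.SegOn s p) (hx : x ∈ N.pathVerts p)
    (h₁ : ord s.1 ≤ ord x) (h₂ : ord x ≤ ord (N.segEnd s)) : x ∈ N.segVerts s := by
  obtain ⟨L, R, e, hL, hR⟩ := (h.segOn_iff hs).1 hsp
  have hw := isSeg_iff.1 hs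
  obtain ⟨L₁, M, R₁, e₁, hL₁, hM, hR₁⟩ := IsWalk.split_two ho h hsp.2 hx h₁
  have e' := e.symm.trans e₁
  rw [List.append_assoc, List.append_assoc] at e'
  obtain ⟨rfl, e₂⟩ := hL.split_unique ho hL₁ e'
  rcases List.append_eq_append_iff.1 e₂ with ⟨m, f₁, f₂⟩ | ⟨m, f₁, f₂⟩
  · subst f₁
    obtain ⟨z, hz, hm⟩ := isWalk_append.1 hM
    obtain rfl := hw.end_unique hz
    obtain rfl := hm.eq_nil ho h₂
    obtain rfl : N.segEnd s = x := hm
    exact hs.end_mem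
  · rw [f₁] at hw
    obtain ⟨z, hz, hm⟩ := isWalk_append.1 hw
    obtain rfl := hM.end_unique hz
    exact (isSeg_iff.1 hs).mem_segVerts.2 ⟨M, m, f₁, hM, hm⟩

end Order

section CommonSegments

variable {k : ℕ} {N : KPairNetwork k} {u v u' v' x : N.V} {p q : List N.A}
  {ord : N.V → ℕ} {s t : N.V × List N.A}

theorem isLCS_pair : N.IsLCS {p, q} s ↔ N.IsSeg s ∧ N.SegOn s p ∧ N.SegOn s q ∧
    ∀ s', N.IsSeg s' → N.SegLE s s' → N.SegOn s' p → N.SegOn s' q → s' = s := by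
  simp only [IsLCS, Set.mem_insert_iff, Set.mem_singleton_iff, forall_eq_or_imp, forall_eq,
    exists_eq_or_imp, exists_eq_left]
  grind

/-- Every common segment extends to a longest common segment. -/
theorem exists_isLCS (hs : N.IsSeg s) (hp : N.SegOn s p) (hq : N.SegOn s q) :
    ∃ t, N.IsLCS {p, q} t ∧ N.SegLE s t := by
  induction hn : p.length - s.2.length using Nat.strong_induction_on generalizing s with
  | _ n ih =>
    by_cases hL : N.IsLCS {p, q} s
    · exact ⟨s, hL, List.infix_refl _, start_mem s⟩
    · rw [isLCS_pair] at hL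
      push Not at hL
      obtain ⟨s', hs', hle, hp', hq', hne⟩ := hL hs hp hq
      have hlt : s.2.length < s'.2.length := by
        refine lt_of_le_of_ne hle.1.length_le fun e => hne ?_
        have e2 : s.2 = s'.2 := hle.1.eq_of_length e
        refine Prod.ext ?_ e2.symm
        cases h2 : s.2 with
        | nil =>
          have := hle.2
          rw [segVerts, ← e2, h2] at this
          simpa [pathVerts, eq_comm] using this
        | cons a l =>
          rw [← hs.2 a (by simp [h2]), ← hs'.2 a (by simp [← e2, h2])]
      have := hp'.1.length_le
      obtain ⟨t, ht, hle'⟩ := ih _ (by omega) hs' hp' hq' rfl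
      exact ⟨t, ht, hle.1.trans hle'.1, segVerts_mono hle' hle.2⟩

theorem exists_common_suffix {α : Type*} {S T L : List α} (hS : S <:+ L) (hT : T <:+ L) :
    ∃ M, S <:+ M ∧ T <:+ M ∧ (M = S ∨ M = T) := by
  rcases List.suffix_or_suffix_of_suffix hS hT with h | h
  · exact ⟨T, h, List.suffix_rfl, Or.inr rfl⟩
  · exact ⟨S, List.suffix_rfl, h, Or.inl rfl⟩

theorem exists_common_prefix {α : Type*} {S T L : List α} (hS : S <+: L) (hT : T <+: L) :
    ∃ M, S <+: M ∧ T <+: M ∧ (M = S ∨ M = T) := by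
  rcases List.prefix_or_prefix_of_prefix hS hT with h | h
  · exact ⟨T, h, List.prefix_rfl, Or.inr rfl⟩
  · exact ⟨S, List.prefix_rfl, h, Or.inl rfl⟩

theorem SegOn.split_at (ho : N.IsTopOrder ord) (h : N.IsPathFrom u v p) (hs : N.IsSeg s)
    (hsp : N.SegOn s p) {S₁ S₂ X Y : List N.A} (e : s.2 = S₁ ++ S₂) (h₁ : N.IsWalk s.1 S₁ x)
    (ep : p = X ++ Y) (hX : N.IsWalk u X x) : S₁ <:+ X ∧ S₂ <+: Y := by
  obtain ⟨L, R, e', hL, hR⟩ := (h.segOn_iff hs).1 hsp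
  have : (L ++ S₁) ++ (S₂ ++ R) = X ++ Y := by rw [← ep, e', e]; simp
  obtain ⟨rfl, rfl⟩ := (hL.append h₁).split_unique ho hX this
  exact ⟨List.suffix_append _ _, List.prefix_append _ _⟩

/-- Longest common segments of the same pair of paths that meet are equal. -/
theorem IsLCS.eq_of_mem (ho : N.IsTopOrder ord) (hp : N.IsPathFrom u v p)
    (hq : N.IsPathFrom u' v' q) (hs : N.IsLCS {p, q} s) (ht : N.IsLCS {p, q} t)
    (hxs : x ∈ N.segVerts s) (hxt : x ∈ N.segVerts t) : s = t := by
  rw [isLCS_pair] at hs ht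
  obtain ⟨hs, hsp, hsq, hsm⟩ := hs
  obtain ⟨ht, htp, htq, htm⟩ := ht
  obtain ⟨S₁, S₂, es, hS₁, hS₂⟩ := (isSeg_iff.1 hs).mem_segVerts.1 hxs
  obtain ⟨T₁, T₂, et, hT₁, hT₂⟩ := (isSeg_iff.1 ht).mem_segVerts.1 hxt
  obtain ⟨X, Y, ep, hX, hY⟩ := hp.mem_pathVerts.1 (hsp.segVerts_subset hxs)
  obtain ⟨X', Y', eq, hX', hY'⟩ := hq.mem_pathVerts.1 (hsq.segVerts_subset hxs)
  have a := hsp.split_at ho hp hs es hS₁ ep hX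
  have b := htp.split_at ho hp ht et hT₁ ep hX
  have a' := hsq.split_at ho hq hs es hS₁ eq hX'
  have b' := htq.split_at ho hq ht et hT₁ eq hX'
  obtain ⟨M₁, sM₁, tM₁, hM₁⟩ := exists_common_suffix a.1 b.1
  obtain ⟨M₂, sM₂, tM₂, hM₂⟩ := exists_common_prefix a.2 b.2
  obtain ⟨m, hm⟩ : ∃ m, N.IsWalk m M₁ x := by
    rcases hM₁ with rfl | rfl
    exacts [⟨_, hS₁⟩, ⟨_, hT₁⟩]
  obtain ⟨m', hm'⟩ : ∃ m', N.IsWalk x M₂ m' := by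
    rcases hM₂ with rfl | rfl
    exacts [⟨_, hS₂⟩, ⟨_, hT₂⟩]
  have hseg : N.IsSeg (m, M₁ ++ M₂) := (hm.append hm').isSeg
  have on : ∀ {u v : N.V} {p X Y : List N.A}, N.IsPathFrom u v p → p = X ++ Y →
      N.IsWalk u X x → M₁ <:+ X → M₂ <+: Y → N.SegOn (m, M₁ ++ M₂) p := by
    rintro u v p _ _ hp rfl hX ⟨X', rfl⟩ ⟨Y', rfl⟩
    obtain ⟨z, hz, hz'⟩ := isWalk_append.1 hX
    obtain rfl := hz'.start_unique hm
    refine ⟨⟨X', Y', by simp⟩, ?_⟩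
    have hw := hp.isWalk
    rw [List.append_assoc] at hw
    obtain ⟨y, hy, hy'⟩ := isWalk_append.1 hw
    obtain rfl := hy.end_unique hz
    exact hp.mem_pathVerts.2 ⟨X', M₁ ++ (M₂ ++ Y'), by simp, hy, hy'⟩
  have hMp : N.SegOn (m, M₁ ++ M₂) p := on hp ep hX
    (by rcases hM₁ with rfl | rfl; exacts [a.1, b.1])
    (by rcases hM₂ with rfl | rfl; exacts [a.2, b.2])
  have hMq : N.SegOn (m, M₁ ++ M₂) q := on hq eq hX'
    (by rcases hM₁ with rfl | rfl; exacts [a'.1, b'.1])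
    (by rcases hM₂ with rfl | rfl; exacts [a'.2, b'.2])
  have le : ∀ {r : N.V × List N.A} {R₁ R₂ : List N.A}, r.2 = R₁ ++ R₂ → N.IsWalk r.1 R₁ x →
      R₁ <:+ M₁ → R₂ <+: M₂ → N.SegLE r (m, M₁ ++ M₂) := by
    rintro r R₁ R₂ e hR ⟨X', rfl⟩ ⟨Y', rfl⟩
    refine ⟨⟨X', Y', by simp [e]⟩, ?_⟩
    obtain ⟨z, hz, hz'⟩ := isWalk_append.1 hm
    obtain rfl := hz'.start_unique hR
    refine (hm.append hm').mem_segVerts.2 ⟨X', R₁ ++ (R₂ ++ Y'), by simp, hz, hz'.append hm'⟩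
  exact (hsm _ hseg (le es hS₁ sM₁ sM₂) hMp hMq).symm.trans
    (htm _ hseg (le et hT₁ tM₁ tM₂) hMp hMq)

end CommonSegments
end KPairNetwork

/-- `x` is a next crossing after `y` in column `b`. -/
def ColNext {k : ℕ} {S : Type*} (C : Fin k → Fin k → S → Prop) (o : S → ℕ) (b : Fin k)
    (y x : S) : Prop :=
  o y < o x ∧ ∀ a z, C a b z → o y < o z → o x ≤ o z

/-- A system of row paths and column paths meeting in crossings: `C a b s` says that `s` is a
crossing of row `a` and column `b`, `o` orders the crossings along the paths, and `σ a` is the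
first crossing both of row `a` and of column `a`. The last four fields say that no rerouting of
the rows along columns, or of the columns along rows, is possible. -/
structure CrossingPattern {k : ℕ} {S : Type*} (C : Fin k → Fin k → S → Prop) (o : S → ℕ)
    (σ : Fin k → S) : Prop where
  idx : ∀ {a b a' b' s}, C a b s → C a' b' s → a = a' ∧ b = b'
  row_inj : ∀ {a b b' s s'}, C a b s → C a b' s' → o s = o s' → s = s'
  col_inj : ∀ {a a' b s s'}, C a b s → C a' b s' → o s = o s' → s = s'
  source : ∀ a, C a a (σ a)
  row_source : ∀ {a b s}, C a b s → o (σ a) ≤ o s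
  col_source : ∀ {a b s}, C a b s → o (σ b) ≤ o s
  col_loop : ∀ {a b y x}, C a b y → C a b x → ¬ ColNext C o b y x
  row_loop : ∀ {a b y x}, C a b y → C a b x → ¬ ColNext (fun b a => C a b) o a y x
  col_switch : ∀ {a a' b b' y x y' x'}, a ≠ a' → C a b y → C a' b x' → ColNext C o b y x' →
    C a' b' y' → C a b' x → ColNext C o b' y' x → o y < o x → o y' < o x' → False
  row_switch : ∀ {a a' b b' y x y' x'}, b ≠ b' → C a b y → C a b' x' →
    ColNext (fun b a => C a b) o a y x' → C a' b' y' → C a' b x →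
    ColNext (fun b a => C a b) o a' y' x → o y < o x → o y' < o x' → False

section Next

variable {k : ℕ} {S : Type*} {C : Fin k → Fin k → S → Prop} {o : S → ℕ}

theorem exists_colNext {a b : Fin k} {y z : S} (hz : C a b z) (h : o y < o z) :
    ∃ a' x, C a' b x ∧ ColNext C o b y x := by
  classical
  have hex : ∃ n, ∃ a' x, C a' b x ∧ o y < o x ∧ o x = n := ⟨_, a, z, hz, h, rfl⟩
  obtain ⟨a', x, hx, hlt, hn⟩ := Nat.find_spec hex
  exact ⟨a', x, hx, hlt, fun a z hz hyz => hn ▸ Nat.find_min' hex ⟨a, z, hz, hyz, rfl⟩⟩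

theorem exists_colPrev {a b : Fin k} {y z : S} (hy : C a b y) (h : o y < o z) :
    ∃ a' x, C a' b x ∧ ColNext C o b x z ∧ o y ≤ o x := by
  classical
  have hex : ∃ n, ∃ a' x, C a' b x ∧ o y ≤ o x ∧ o x < o z ∧ o z - o x = n :=
    ⟨_, a, y, hy, le_rfl, h, rfl⟩
  obtain ⟨a', x, hx, hle, hlt, hn⟩ := Nat.find_spec hex
  refine ⟨a', x, hx, ⟨hlt, fun a w hw hxw => ?_⟩, hle⟩
  by_contra! hwz
  have := Nat.find_min' hex ⟨a, w, hw, by omega, hwz, rfl⟩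
  omega

/-- `e 0, …, e (L - 1)` enumerates the crossings of column `b` in increasing order. -/
structure IsColEnum (C : Fin k → Fin k → S → Prop) (o : S → ℕ) (b : Fin k) (e : ℕ → S)
    (L : ℕ) : Prop where
  mem : ∀ n < L, ∃ a, C a b (e n)
  surj : ∀ a s, C a b s → ∃ n < L, e n = s
  lt : ∀ m n, m < n → n < L → o (e m) < o (e n)

namespace IsColEnum

variable {b : Fin k} {e : ℕ → S} {L : ℕ}

theorem zero {σ : Fin k → S} (he : IsColEnum C o b e L) (h : CrossingPattern C o σ) :
    0 < L ∧ e 0 = σ b := by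
  obtain ⟨n, hn, hs⟩ := he.surj b _ (h.source b)
  have hL : 0 < L := by omega
  refine ⟨hL, ?_⟩
  rcases n.eq_zero_or_pos with rfl | hpos
  · exact hs
  · obtain ⟨a, ha⟩ := he.mem 0 hL
    have h₁ := h.col_source ha
    have h₂ := he.lt 0 n hpos hn
    rw [hs] at h₂
    omega

theorem succ (he : IsColEnum C o b e L) {a : Fin k} {n : ℕ} {x : S} (hx : C a b x)
    (h : ColNext C o b (e n) x) (hn : n < L) : n + 1 < L ∧ e (n + 1) = x := by
  obtain ⟨m, hm, rfl⟩ := he.surj a x hx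
  have hnm : n < m := by
    by_contra! hmn
    have h₁ := h.1
    rcases hmn.eq_or_lt with rfl | hmn
    · omega
    · have := he.lt m n hmn hn
      omega
  have hn' : n + 1 < L := by omega
  refine ⟨hn', ?_⟩
  rcases (show n + 1 ≤ m from hnm).eq_or_lt with rfl | hlt
  · rfl
  · obtain ⟨a', ha'⟩ := he.mem (n + 1) hn'
    have h₁ := h.2 a' _ ha' (he.lt n (n + 1) (by omega) hn')
    have h₂ := he.lt (n + 1) m hlt hm
    omega

end IsColEnum

end Next

namespace CrossingPattern

variable {S : Type*} {C : Fin 3 → Fin 3 → S → Prop} {o : S → ℕ} {σ : Fin 3 → S} {i j l : Fin 3}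

theorem swap (h : CrossingPattern C o σ) : CrossingPattern (fun b a => C a b) o σ where
  idx h₁ h₂ := (h.idx h₁ h₂).symm
  row_inj := h.col_inj
  col_inj := h.row_inj
  source := h.source
  row_source := h.col_source
  col_source := h.row_source
  col_loop := h.row_loop
  row_loop := h.col_loop
  col_switch := h.row_switch
  row_switch := h.col_switch

/-- The pattern has a trivial row `i` and a trivial column `l`, while row `j` and column `j` are
not trivial, where `i`, `j`, `l` are the three indices. -/
structure IsNondegenerate (C : Fin 3 → Fin 3 → S → Prop) (σ : Fin 3 → S)
    (i j l : Fin 3) : Prop where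
  ne_ij : i ≠ j
  ne_il : i ≠ l
  ne_jl : j ≠ l
  row_trivial : ∀ b s, C i b s → s = σ i
  col_trivial : ∀ a s, C a l s → s = σ l
  row_exists : ∃ b s, C j b s ∧ s ≠ σ j
  col_exists : ∃ a s, C a j s ∧ s ≠ σ j

theorem IsNondegenerate.swap (hn : IsNondegenerate C σ i j l) :
    IsNondegenerate (fun b a => C a b) σ l j i :=
  ⟨hn.ne_jl.symm, hn.ne_il.symm, hn.ne_ij.symm, fun b s => hn.col_trivial b s,
    fun a s => hn.row_trivial a s, hn.col_exists, hn.row_exists⟩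

theorem IsNondegenerate.eq_or (hn : IsNondegenerate C σ i j l) (a : Fin 3) :
    a = i ∨ a = j ∨ a = l := by
  have := hn.ne_ij
  have := hn.ne_il
  have := hn.ne_jl
  omega

variable {a a' b : Fin 3} {x y z : S}

/-- Consecutive crossings of a column lie on distinct rows. -/
theorem next_row (h : CrossingPattern C o σ) (hn : IsNondegenerate C σ i j l)
    (hy : C a b y) (hx : C a' b x) (hyx : ColNext C o b y x) : a' ≠ a ∧ a' ≠ i := by
  refine ⟨?_, ?_⟩
  · rintro rfl
    exact h.col_loop hy hx hyx
  · rintro rfl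
    obtain rfl := hn.row_trivial b x hx
    obtain ⟨-, rfl⟩ := h.idx (h.source a') hx
    exact (h.col_source hy).not_gt hyx.1

theorem exists_next (h : CrossingPattern C o σ) (hn : IsNondegenerate C σ i j l)
    (hy : C a b y) (hz : C a' b z) (hyz : o y < o z) :
    ∃ c x, C c b x ∧ ColNext C o b y x ∧ o x ≤ o z ∧ c ≠ a ∧ c ≠ i := by
  obtain ⟨c, x, hx, hyx⟩ := exists_colNext hz hyz
  exact ⟨c, x, hx, hyx, hyx.2 _ _ hz hyz, h.next_row hn hy hx hyx⟩

theorem exists_next_of_middle (h : CrossingPattern C o σ) (hn : IsNondegenerate C σ i j l)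
    (hy : C j b y) (hz : C a' b z) (hyz : o y < o z) :
    ∃ x, C l b x ∧ ColNext C o b y x ∧ o x ≤ o z := by
  obtain ⟨c, x, hx, hyx, hle, h₁, h₂⟩ := h.exists_next hn hy hz hyz
  obtain rfl : c = l := by have := hn.eq_or c; tauto
  exact ⟨x, hx, hyx, hle⟩

theorem exists_next_of_last (h : CrossingPattern C o σ) (hn : IsNondegenerate C σ i j l)
    (hy : C l b y) (hz : C a' b z) (hyz : o y < o z) :
    ∃ x, C j b x ∧ ColNext C o b y x ∧ o x ≤ o z := by
  obtain ⟨c, x, hx, hyx, hle, h₁, h₂⟩ := h.exists_next hn hy hz hyz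
  obtain rfl : c = j := by have := hn.eq_or c; tauto
  exact ⟨x, hx, hyx, hle⟩

theorem source_lt (h : CrossingPattern C o σ) (hx : C a b x) (hne : x ≠ σ b) :
    o (σ b) < o x :=
  (h.col_source hx).lt_of_ne fun e => hne (h.col_inj (h.source b) hx e).symm

theorem ne_source (h : CrossingPattern C o σ) (hx : C a b x) (hab : a ≠ b) (c : Fin 3) :
    x ≠ σ c := by
  rintro rfl
  obtain ⟨rfl, rfl⟩ := h.idx hx (h.source _)
  exact hab rfl

/-- The second crossing of column `j` lies on row `l`. -/
theorem exists_second (h : CrossingPattern C o σ) (hn : IsNondegenerate C σ i j l) :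
    ∃ z, C l j z ∧ ColNext C o j (σ j) z := by
  obtain ⟨a, s, hs, hne⟩ := hn.col_exists
  obtain ⟨x, hx, hyx, -⟩ := h.exists_next_of_middle hn (h.source j) hs (h.source_lt hs hne)
  exact ⟨x, hx, hyx⟩

/-- Row `j` and column `i` cross only once. -/
theorem eq_of_row_next (h : CrossingPattern C o σ) (hn : IsNondegenerate C σ i j l)
    {p q : S} (hp : C j i p) (hpn : ColNext (fun b a => C a b) o j (σ j) p) (hq : C j i q) :
    q = p := by
  by_contra hqp
  have hji := hn.ne_ij.symm
  have hle : o p ≤ o q :=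
    hpn.2 _ _ hq (h.swap.source_lt (a := i) (b := j) hq (h.ne_source hq hji j))
  have hlt : o p < o q := hle.lt_of_ne fun e => hqp (h.col_inj hp hq e).symm
  obtain ⟨z, hz, hzn⟩ := h.exists_second hn
  obtain ⟨x, hx, hxn, hxq⟩ := h.exists_next_of_middle hn hp hq hlt
  obtain ⟨b, hb, hbn, hbq⟩ := h.swap.exists_next_of_last hn.swap (y := p) (z := q) hp hq hlt
  have hxq' : o x < o q := hxq.lt_of_ne fun e => hn.ne_jl
    (h.idx (h.col_inj hx hq e ▸ hx) hq).1.symm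
  have hσp := hpn.1
  have hpb := hbn.1
  have hpx := hxn.1
  have hzb : o z < o b := by
    refine (hzn.2 _ _ hb (hσp.trans hpb)).lt_of_ne fun e => hn.ne_jl ?_
    exact (h.idx (h.col_inj hz hb e ▸ hz) hb).1.symm
  obtain ⟨b', hb', hbn', hbb'⟩ := h.exists_next_of_last hn hz hb hzb
  have hbb : b' = b := by
    refine h.col_inj hb' hb (hbb'.antisymm ?_)
    have h₁ : o (σ j) < o b' := hzn.1.trans hbn'.1
    have h₂ := hpn.2 _ _ hb' h₁
    refine hbn.2 _ _ hb' (h₂.lt_of_ne fun e => hn.ne_ij ?_)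
    exact (h.idx (h.row_inj hp hb' e ▸ hp) hb').2
  subst hbb
  have hxz : o x < o z := by
    by_contra! hzx
    rcases hzx.eq_or_lt with e | hzx
    · exact hn.ne_ij (h.idx (h.row_inj hx hz e.symm ▸ hx) hz).2
    · exact h.col_switch hn.ne_jl.symm hz hb hbn' hp hx hxn hzx hpb
  obtain ⟨a, v, hv, hvn, hxv⟩ := exists_colPrev hx (hxq')
  obtain rfl : a = l := by
    have hai : a ≠ i := by
      rintro rfl
      obtain rfl := hn.row_trivial a v hv
      have := h.col_source hp
      omega
    have haj : a ≠ j := by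
      rintro rfl
      exact h.col_loop hv hq hvn
    have := hn.eq_or a
    tauto
  have hzv : o z < o v := by
    by_contra! hvz
    rcases hvz.eq_or_lt with e | hvz
    · exact hn.ne_ij (h.idx (h.row_inj hv hz e ▸ hv) hz).2
    · exact h.col_switch hn.ne_jl.symm hv hq hvn (h.source j) hz hzn hvz (hσp.trans hlt)
  obtain ⟨u, hu, hzu, -⟩ := h.swap.exists_next_of_middle hn.swap hz hv hzv
  have hup : o u ≤ o p := by
    by_contra! hpu
    exact h.row_switch hn.ne_ij.symm hz hu hzu hp hb hbn hzb hpu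
  have := hzu.1
  omega

/-- In a nondegenerate pattern with second crossing `p` of row `j` and second crossing `z` of
column `j`, no crossing precedes both `p` on column `i` and `z` on row `l`. -/
theorem second_ne (h : CrossingPattern C o σ) (hn : IsNondegenerate C σ i j l)
    {p u : S} (hp : C j i p) (hpn : ColNext (fun b a => C a b) o j (σ j) p)
    (hz : C l j z) (hzn : ColNext C o j (σ j) z) (hu : C l i u) (hup : o u < o p)
    (huz : o u < o z) : False := by
  obtain ⟨x, hx, hux, -⟩ := h.exists_next_of_last hn hu hp hup
  obtain rfl := h.eq_of_row_next hn hp hpn hx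
  exact h.col_switch hn.ne_jl (h.source j) hz hzn hu hp hux hpn.1 huz

/-- The crossing of row `j` and column `i` is the second or the third one of column `i`, and in
the latter case the second one lies on row `l`. -/
theorem second_or_third (h : CrossingPattern C o σ) (hn : IsNondegenerate C σ i j l) {p : S}
    (hp : C j i p) (hpn : ColNext (fun b a => C a b) o j (σ j) p) {e : ℕ → S} {L : ℕ}
    (he : IsColEnum C o i e L) :
    ∃ a, C a i (e 1) ∧ ColNext C o i (σ i) (e 1) ∧ 2 ≤ L ∧
      (e 1 = p ∨ (a = l ∧ o (e 1) < o p ∧ 3 ≤ L ∧ e 2 = p)) := by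
  obtain ⟨hL, h0⟩ := he.zero h
  obtain ⟨a, x, hx, hxn, hxp, hai, -⟩ := h.exists_next hn (h.source i) hp
    (h.source_lt hp (h.ne_source hp hn.ne_ij.symm i))
  obtain ⟨hL', rfl⟩ := he.succ hx (h0 ▸ hxn) hL
  refine ⟨a, hx, hxn, hL', ?_⟩
  rcases hn.eq_or a with rfl | rfl | rfl
  · exact absurd rfl hai
  · exact Or.inl (h.eq_of_row_next hn hp hpn hx)
  · have hlt : o (e 1) < o p := hxp.lt_of_ne fun e' => hn.ne_jl
      (h.idx hp (h.col_inj hx hp e' ▸ hx)).1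
    obtain ⟨y, hy, hyn, -⟩ := h.exists_next_of_last hn hx hp hlt
    obtain rfl := h.eq_of_row_next hn hp hpn hy
    exact Or.inr ⟨rfl, hlt, he.succ hp hyn hL'⟩

theorem classification (h : CrossingPattern C o σ) (hn : IsNondegenerate C σ i j l)
    {cᵢ cⱼ rⱼ rₗ : ℕ → S} {Lcᵢ Lcⱼ Lrⱼ Lrₗ : ℕ} (hcᵢ : IsColEnum C o i cᵢ Lcᵢ)
    (hcⱼ : IsColEnum C o j cⱼ Lcⱼ) (hrⱼ : IsColEnum (fun b a => C a b) o j rⱼ Lrⱼ)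
    (hrₗ : IsColEnum (fun b a => C a b) o l rₗ Lrₗ) :
    (2 ≤ Lcᵢ ∧ 2 ≤ Lrₗ ∧ cᵢ 1 ≠ rₗ 1) ∧
    ((∃! s, C j i s) ∧ ∃! s, C l j s) ∧
    ((2 ≤ Lcᵢ ∧ 2 ≤ Lrⱼ ∧ 2 ≤ Lcⱼ ∧ 2 ≤ Lrₗ ∧ cᵢ 1 = rⱼ 1 ∧ cⱼ 1 = rₗ 1) ∨
     (2 ≤ Lcᵢ ∧ 2 ≤ Lrⱼ ∧ 2 ≤ Lcⱼ ∧ 3 ≤ Lrₗ ∧ cᵢ 1 = rⱼ 1 ∧ cⱼ 1 = rₗ 2) ∨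
     (3 ≤ Lcᵢ ∧ 2 ≤ Lrⱼ ∧ 2 ≤ Lcⱼ ∧ 2 ≤ Lrₗ ∧ cᵢ 2 = rⱼ 1 ∧ cⱼ 1 = rₗ 1)) := by
  obtain ⟨z, hz, hzn⟩ := h.exists_second hn
  obtain ⟨p, hp, hpn⟩ := h.swap.exists_second hn.swap
  obtain ⟨hLcⱼ, hcⱼ0⟩ := hcⱼ.zero h
  obtain ⟨hLrⱼ, hrⱼ0⟩ := hrⱼ.zero h.swap
  obtain ⟨hLcⱼ', rfl⟩ := hcⱼ.succ hz (hcⱼ0 ▸ hzn) hLcⱼ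
  obtain ⟨hLrⱼ', rfl⟩ := hrⱼ.succ hp (hrⱼ0 ▸ hpn) hLrⱼ
  obtain ⟨a, ha, han, hLcᵢ, ha'⟩ := h.second_or_third hn hp hpn hcᵢ
  obtain ⟨b, hb, hbn, hLrₗ, hb'⟩ := h.swap.second_or_third hn.swap hz hzn hrₗ
  have hne : cᵢ 1 ≠ rₗ 1 := by
    intro e
    have hu := h.idx ha (e ▸ hb)
    obtain ⟨rfl, rfl⟩ := hu
    have h₁ : cᵢ 1 ≠ rⱼ 1 := fun e' => hn.ne_jl (h.idx hp (e' ▸ ha)).1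
    have h₂ : rₗ 1 ≠ cⱼ 1 := fun e' => hn.ne_ij (h.idx (e' ▸ hb) hz).2
    obtain ha' := ha'.resolve_left h₁
    obtain hb' := hb'.resolve_left h₂
    exact h.second_ne hn hp hpn hz hzn ha ha'.2.1 (e ▸ hb'.2.1)
  refine ⟨⟨hLcᵢ, hLrₗ, hne⟩, ⟨⟨rⱼ 1, hp, fun q hq => h.eq_of_row_next hn hp hpn hq⟩,
    ⟨cⱼ 1, hz, fun q hq => h.swap.eq_of_row_next hn.swap hz hzn hq⟩⟩, ?_⟩
  rcases ha' with ha' | ⟨rfl, -, hL₃, ha'⟩ <;> rcases hb' with hb' | ⟨rfl, -, hL₃', hb'⟩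
  · exact Or.inl ⟨hLcᵢ, hLrⱼ', hLcⱼ', hLrₗ, ha', hb'.symm⟩
  · exact Or.inr (Or.inl ⟨hLcᵢ, hLrⱼ', hLcⱼ', hL₃', ha', hb'.symm⟩)
  · exact Or.inr (Or.inr ⟨hL₃, hLrⱼ', hLcⱼ', hLrₗ, ha', hb'.symm⟩)
  · have h₁ := han.2 _ _ hb (h.source_lt hb (h.ne_source hb hn.ne_il.symm _))
    have h₂ := hbn.2 _ _ ha (h.swap.source_lt (a := b) ha (h.ne_source ha hn.ne_il.symm _))
    exact absurd (h.col_inj ha hb (h₁.antisymm h₂)) hne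

end CrossingPattern

namespace KPairNetwork

section Routing

variable {k : ℕ} {N : KPairNetwork k} {p q : Fin k → List N.A} {ord : N.V → ℕ} {c d : Fin k}

/-- `p` is the unique family of pairwise arc-disjoint paths from the sources to `snk c`. -/
structure IsUniqueRouting (N : KPairNetwork k) (c : Fin k) (p : Fin k → List N.A) : Prop where
  path : ∀ i, N.IsPathFrom (N.src i) (N.snk c) (p i)
  disj : ∀ i i', i ≠ i' → ∀ a : N.A, a ∈ p i → a ∉ p i'
  uniq : ∀ q : Fin k → List N.A, (∀ i, N.IsPathFrom (N.src i) (N.snk c) (q i)) →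
    (∀ i i', i ≠ i' → ∀ a : N.A, a ∈ q i → a ∉ q i') → ∀ i, q i = p i

theorem IsStableSystem.isUniqueRouting {P : Fin k → Fin k → List N.A}
    (h : N.IsStableSystem P) (c : Fin k) : N.IsUniqueRouting c fun i => P i c :=
  ⟨fun i => h.1.1 i c, h.1.2 c, h.2 c⟩

theorem IsPathFrom.sink_notMem {u : N.V} {l : List N.A} (h : N.IsPathFrom u (N.snk d) l)
    (hcd : c ≠ d) : N.snk c ∉ N.pathVerts l := by
  intro hc
  obtain ⟨L, R, -, -, hR⟩ := h.mem_pathVerts.1 hc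
  cases R with
  | nil => exact hcd (N.snk_inj hR)
  | cons a R => exact N.snk_no_out c a hR.1

namespace IsUniqueRouting

theorem ne_nil (h : N.IsUniqueRouting c p) {a : Fin k} {l : List N.A}
    (hl : N.IsWalk (N.src a) l (N.snk c)) : l ≠ [] := by
  rintro rfl
  have hw := (h.path a).isWalk
  have hne := (h.path a).1
  cases hp : p a with
  | nil => exact hne hp
  | cons e m =>
    rw [hp] at hw
    exact N.snk_no_out c e (hw.1.trans hl)

/-- A walk with the ends of `p a` using no arc of the other paths is `p a`. -/
theorem eq_of_reroute (h : N.IsUniqueRouting c p) {a : Fin k} {l : List N.A}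
    (hl : N.IsWalk (N.src a) l (N.snk c)) (hd : ∀ i, i ≠ a → ∀ e ∈ l, e ∉ p i) : l = p a := by
  have := h.uniq (Function.update p a l) (fun i => ?_) (fun i i' hii e he he' => ?_) a
  · simpa using this
  · by_cases hi : i = a
    · subst hi
      simpa using isPathFrom_iff.2 ⟨h.ne_nil hl, hl⟩
    · simpa [hi] using h.path i
  · have := h.disj
    simp only [Function.update_apply] at he he'
    grind

/-- Exchanging the final parts of two paths, by way of disjoint connecting walks that use no arc
of the routing, does not change the paths. -/
theorem eq_of_switch (h : N.IsUniqueRouting c p) {a a' : Fin k} (ha : a ≠ a')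
    {L M R L' M' R' X X' : List N.A} (e : p a = L ++ M ++ R) (e' : p a' = L' ++ M' ++ R')
    (hw : N.IsWalk (N.src a) (L ++ X ++ R') (N.snk c))
    (hw' : N.IsWalk (N.src a') (L' ++ X' ++ R) (N.snk c))
    (hX : ∀ f ∈ X, ∀ i, f ∉ p i) (hX' : ∀ f ∈ X', ∀ i, f ∉ p i) (hXX : ∀ f ∈ X, f ∉ X')
    (hL : ∀ f ∈ L, f ∉ R) (hL' : ∀ f ∈ L', f ∉ R') :
    L ++ X ++ R' = p a := by
  set Q := Function.update (Function.update p a (L ++ X ++ R')) a' (L' ++ X' ++ R) with hQ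
  have hQa : Q a = L ++ X ++ R' := by simp [hQ, ha]
  have hQa' : Q a' = L' ++ X' ++ R := by simp [hQ]
  have hQi : ∀ i, i ≠ a → i ≠ a' → Q i = p i := fun i hi hi' => by simp [hQ, hi, hi']
  have memQa : ∀ f, f ∈ Q a → f ∈ L ∨ f ∈ X ∨ f ∈ R' := fun f hf => by simpa [hQa] using hf
  have memQa' : ∀ f, f ∈ Q a' → f ∈ L' ∨ f ∈ X' ∨ f ∈ R := fun f hf => by simpa [hQa'] using hf
  have mem : ∀ f, f ∈ L ∨ f ∈ R → f ∈ p a := fun f hf => by rw [e]; simp; tauto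
  have mem' : ∀ f, f ∈ L' ∨ f ∈ R' → f ∈ p a' := fun f hf => by rw [e']; simp; tauto
  have disj := h.disj
  have haa' : ∀ f, f ∈ Q a → f ∉ Q a' := fun f hf hf' => by
    have d₁ := disj a a' ha f
    rcases memQa f hf with hf | hf | hf <;> rcases memQa' f hf' with hf' | hf' | hf' <;> grind
  have hai : ∀ i f, i ≠ a → i ≠ a' → f ∈ p i → f ∉ Q a ∧ f ∉ Q a' := fun i f hi hi' hf =>
    ⟨fun hf' => by rcases memQa f hf' with hf' | hf' | hf' <;> grind,
      fun hf' => by rcases memQa' f hf' with hf' | hf' | hf' <;> grind⟩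
  rw [← hQa]
  refine h.uniq Q (fun i => ?_) (fun i i' hii f hf hf' => ?_) a
  · by_cases hi : i = a
    · subst hi
      exact isPathFrom_iff.2 ⟨h.ne_nil (hQa ▸ hw), hQa ▸ hw⟩
    by_cases hi' : i = a'
    · subst hi'
      exact isPathFrom_iff.2 ⟨h.ne_nil (hQa' ▸ hw'), hQa' ▸ hw'⟩
    · exact hQi i hi hi' ▸ h.path i
  · by_cases h₁ : i = a <;> by_cases h₂ : i = a' <;> by_cases h₃ : i' = a <;>
      by_cases h₄ : i' = a' <;> grind

end IsUniqueRouting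

theorem IsWalk.ord_mem (ho : N.IsTopOrder ord) {u v : N.V} {l : List N.A} {e : N.A}
    (h : N.IsWalk u l v) (he : e ∈ l) : ord u ≤ ord (N.tail e) ∧ ord (N.head e) ≤ ord v := by
  obtain ⟨l₁, l₂, rfl⟩ := List.append_of_mem he
  obtain ⟨w, h₁, h₂⟩ := isWalk_append.1 h
  exact ⟨h₂.1 ▸ h₁.ord_le ho, h₂.2.ord_le ho⟩

theorem IsWalk.disjoint_of_le (ho : N.IsTopOrder ord) {u v u' v' : N.V} {l l' : List N.A}
    (h : N.IsWalk u l v) (h' : N.IsWalk u' l' v') (hv : ord v ≤ ord u') : ∀ e ∈ l, e ∉ l' := by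
  intro e he he'
  have := ho e
  have := (h.ord_mem ho he).2
  have := (h'.ord_mem ho he').1
  omega

namespace IsUniqueRouting

/-- The paths of a unique routing meet at the sink only. -/
theorem idx_eq (ho : N.IsTopOrder ord) (h : N.IsUniqueRouting c p) {a a' : Fin k} {v : N.V}
    (hv : v ∈ N.pathVerts (p a)) (hv' : v ∈ N.pathVerts (p a')) (hc : v ≠ N.snk c) : a = a' := by
  by_contra ha
  obtain ⟨L, R, e, hL, hR⟩ := (h.path a).mem_pathVerts.1 hv
  obtain ⟨L', R', e', hL', hR'⟩ := (h.path a').mem_pathVerts.1 hv'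
  have key := h.eq_of_switch ha (M := []) (M' := []) (X := []) (X' := []) (by simpa using e)
    (by simpa using e') (by simpa using hL.append hR') (by simpa using hL'.append hR)
    (by simp) (by simp) (by simp) (hL.disjoint_of_le ho hR le_rfl)
    (hL'.disjoint_of_le ho hR' le_rfl)
  obtain ⟨f, hf⟩ : ∃ f, f ∈ R' := by
    cases R' with
    | nil => exact absurd hR' hc
    | cons f _ => exact ⟨f, List.mem_cons_self⟩
  exact h.disj a a' ha f (by rw [← key]; simp [hf]) (by rw [e']; simp [hf])

variable {a a' b b' : Fin k} {s t : N.V × List N.A} {x : N.V}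

theorem row_eq (ho : N.IsTopOrder ord) (hp : N.IsUniqueRouting c p)
    (hq : N.IsUniqueRouting d q) (hcd : c ≠ d) (hs : N.IsLCS {p a, q b} s)
    (hx : x ∈ N.segVerts s) (hx' : x ∈ N.pathVerts (p a')) : a = a' := by
  rw [isLCS_pair] at hs
  refine hp.idx_eq ho (hs.2.1.segVerts_subset hx) hx' ?_
  rintro rfl
  exact (hq.path b).sink_notMem hcd (hs.2.2.1.segVerts_subset hx)

theorem col_eq (ho : N.IsTopOrder ord) (hp : N.IsUniqueRouting c p)
    (hq : N.IsUniqueRouting d q) (hcd : c ≠ d) (hs : N.IsLCS {p a, q b} s)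
    (hx : x ∈ N.segVerts s) (hx' : x ∈ N.pathVerts (q b')) : b = b' :=
  row_eq ho hq hp hcd.symm (Set.pair_comm (p a) (q b) ▸ hs) hx hx'

theorem lcs_eq (ho : N.IsTopOrder ord) (hp : N.IsUniqueRouting c p)
    (hq : N.IsUniqueRouting d q) (hcd : c ≠ d) (hs : N.IsLCS {p a, q b} s)
    (ht : N.IsLCS {p a', q b'} t) (hxs : x ∈ N.segVerts s) (hxt : x ∈ N.segVerts t) :
    s = t := by
  have ht' := isLCS_pair.1 ht
  obtain rfl := row_eq ho hp hq hcd hs hxs (ht'.2.1.segVerts_subset hxt)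
  obtain rfl := col_eq ho hp hq hcd hs hxs (ht'.2.2.1.segVerts_subset hxt)
  exact hs.eq_of_mem ho (hp.path a) (hq.path b) ht hxs hxt

theorem lcs_eq_of_ord_eq (ho : N.IsTopOrder ord) (hp : N.IsUniqueRouting c p)
    (hq : N.IsUniqueRouting d q) (hcd : c ≠ d) (hs : N.IsLCS {p a, q b} s)
    (ht : N.IsLCS {p a', q b} t) (h : ord s.1 = ord t.1) : s = t := by
  have hs' := isLCS_pair.1 hs
  have ht' := isLCS_pair.1 ht
  exact lcs_eq ho hp hq hcd hs ht (start_mem s)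
    (ht'.2.2.1.mem_of_between ho (hq.path b) ht'.1 hs'.2.2.1.2 h.ge
      (h.le.trans (ht'.1.ord_le_end ho (start_mem t))))

/-- Of two distinct common segments on a column, one ends before the other begins. -/
theorem segEnd_lt (ho : N.IsTopOrder ord) (hp : N.IsUniqueRouting c p)
    (hq : N.IsUniqueRouting d q) (hcd : c ≠ d) (hs : N.IsLCS {p a, q b} s)
    (ht : N.IsLCS {p a', q b} t) (h : ord s.1 < ord t.1) : ord (N.segEnd s) < ord t.1 := by
  by_contra! hle
  have hs' := isLCS_pair.1 hs
  have ht' := isLCS_pair.1 ht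
  have := lcs_eq ho hp hq hcd hs ht
    (hs'.2.2.1.mem_of_between ho (hq.path b) hs'.1 ht'.2.2.1.2 h.le hle) (start_mem t)
  exact h.ne (by rw [this])

theorem exists_connector (ho : N.IsTopOrder ord) (hp : N.IsUniqueRouting c p)
    (hq : N.IsUniqueRouting d q) (hcd : c ≠ d) (hs : N.IsLCS {p a, q b} s)
    (ht : N.IsLCS {p a', q b} t)
    (h : ColNext (fun a b s => N.IsLCS {p a, q b} s) (fun s => ord s.1) b s t) :
    ∃ X, N.IsWalk (N.segEnd s) X t.1 ∧ X ≠ [] ∧ (∀ e ∈ X, e ∈ q b) ∧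
      ∀ e ∈ X, ∀ i, e ∉ p i := by
  have hs' := isLCS_pair.1 hs
  have ht' := isLCS_pair.1 ht
  have hlt := segEnd_lt ho hp hq hcd hs ht h.1
  obtain ⟨L, X, R, e, hL, hX, hR⟩ := IsWalk.split_two ho (hq.path b)
    (hs'.2.2.1.segVerts_subset hs'.1.end_mem) ht'.2.2.1.2 hlt.le
  refine ⟨X, hX, ?_, fun f hf => by rw [e]; simp [hf], fun f hf i hi => ?_⟩
  · rintro rfl
    exact hlt.ne (congrArg ord hX)
  have hf₁ := hX.ord_mem ho hf
  have hf₂ := ho f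
  have on : ∀ {l : List N.A}, f ∈ l → N.SegOn (N.tail f, [f]) l := fun hl =>
    ⟨(List.singleton_infix_iff _ _).2 hl, ⟨f, hl, Or.inl rfl⟩⟩
  have hseg : N.IsSeg (N.tail f, [f]) := IsWalk.isSeg (v := N.head f) ⟨rfl, rfl⟩
  obtain ⟨z, hz, hle⟩ := exists_isLCS hseg (on hi)
    (on (show f ∈ q b by rw [e]; simp [hf]))
  have hz' := isLCS_pair.1 hz
  have htz := segVerts_mono hle (start_mem _)
  have hhz : N.head f ∈ N.segVerts z :=
    segVerts_mono hle (Or.inr ⟨f, List.mem_singleton_self f, Or.inr rfl⟩)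
  have h₁ := hz'.1.ord_start_le ho htz
  have h₂ := hz'.1.ord_le_end ho hhz
  have h₃ : ord s.1 < ord z.1 := by
    by_contra! hzs
    rcases hzs.lt_or_eq with hzs | hzs
    · have := segEnd_lt ho hp hq hcd hz hs hzs
      have := hs'.1.ord_le_end ho (start_mem s)
      omega
    · obtain rfl := lcs_eq_of_ord_eq ho hp hq hcd hz hs hzs
      omega
  have := h.2 i z hz h₃
  dsimp only at this h₁
  omega

theorem not_colNext (ho : N.IsTopOrder ord) (hp : N.IsUniqueRouting c p)
    (hq : N.IsUniqueRouting d q) (hcd : c ≠ d) (hs : N.IsLCS {p a, q b} s)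
    (ht : N.IsLCS {p a, q b} t) :
    ¬ ColNext (fun a b s => N.IsLCS {p a, q b} s) (fun s => ord s.1) b s t := by
  intro h
  obtain ⟨X, hX, hne, -, hXp⟩ := exists_connector ho hp hq hcd hs ht h
  have hs' := isLCS_pair.1 hs
  have ht' := isLCS_pair.1 ht
  obtain ⟨L, M, R, e, hL, hM, hR⟩ := IsWalk.split_two ho (hp.path a)
    (hs'.2.1.segVerts_subset hs'.1.end_mem) ht'.2.1.2 (segEnd_lt ho hp hq hcd hs ht h.1).le
  have key := hp.eq_of_reroute ((hL.append hX).append hR) fun i hi f hf hfi => by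
    have := hp.disj i a hi f hfi
    rw [e] at this
    have := hXp f
    grind
  obtain ⟨f, hf⟩ := List.exists_mem_of_ne_nil X hne
  exact hXp f hf a (by rw [← key]; simp [hf])

theorem no_switch (ho : N.IsTopOrder ord) (hp : N.IsUniqueRouting c p)
    (hq : N.IsUniqueRouting d q) (hcd : c ≠ d) {y x y' x' : N.V × List N.A} (ha : a ≠ a')
    (hy : N.IsLCS {p a, q b} y) (hx' : N.IsLCS {p a', q b} x')
    (h : ColNext (fun a b s => N.IsLCS {p a, q b} s) (fun s => ord s.1) b y x')
    (hy' : N.IsLCS {p a', q b'} y') (hx : N.IsLCS {p a, q b'} x)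
    (h' : ColNext (fun a b s => N.IsLCS {p a, q b} s) (fun s => ord s.1) b' y' x)
    (hyx : ord y.1 < ord x.1) (hyx' : ord y'.1 < ord x'.1) : False := by
  obtain ⟨X, hX, hne, hXq, hXp⟩ := exists_connector ho hp hq hcd hy hx' h
  obtain ⟨X', hX', hne', hXq', hXp'⟩ := exists_connector ho hp hq hcd hy' hx h'
  have flip : ∀ {a b : Fin k} {s : N.V × List N.A}, N.IsLCS {p a, q b} s →
      N.IsLCS {q b, p a} s := fun {a b s} hs => Set.pair_comm (p a) (q b) ▸ hs
  have my := isLCS_pair.1 hy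
  have mx := isLCS_pair.1 hx
  have my' := isLCS_pair.1 hy'
  have mx' := isLCS_pair.1 hx'
  have lt := segEnd_lt ho hq hp hcd.symm (flip hy) (flip hx) hyx
  have lt' := segEnd_lt ho hq hp hcd.symm (flip hy') (flip hx') hyx'
  obtain ⟨L, M, R, e, hL, hM, hR⟩ := IsWalk.split_two ho (hp.path a)
    (my.2.1.segVerts_subset my.1.end_mem) mx.2.1.2 lt.le
  obtain ⟨L', M', R', e', hL', hM', hR'⟩ := IsWalk.split_two ho (hp.path a')
    (my'.2.1.segVerts_subset my'.1.end_mem) mx'.2.1.2 lt'.le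
  have hXX : ∀ f ∈ X, f ∉ X' := by
    by_cases hb : b = b'
    · subst hb
      rcases lt_trichotomy (ord y.1) (ord y'.1) with hlt | heq | hlt
      · refine hX.disjoint_of_le ho hX' ((h.2 _ _ hy' hlt).trans ?_)
        exact my'.1.ord_le_end ho (start_mem y')
      · obtain rfl := lcs_eq_of_ord_eq ho hp hq hcd hy hy' heq
        exact absurd (row_eq ho hp hq hcd hy (start_mem y) my'.2.1.2) ha
      · intro f hf hf'
        refine hX'.disjoint_of_le ho hX ((h'.2 _ _ hy hlt).trans ?_) f hf' hf
        exact my.1.ord_le_end ho (start_mem y)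
    · exact fun f hf hf' => hq.disj b b' hb f (hXq f hf) (hXq' f hf')
  have key := hp.eq_of_switch ha e e' ((hL.append hX).append hR') ((hL'.append hX').append hR)
    hXp hXp' hXX (hL.disjoint_of_le ho hR lt.le) (hL'.disjoint_of_le ho hR' lt'.le)
  obtain ⟨f, hf⟩ := List.exists_mem_of_ne_nil X hne
  exact hXp f hf a (by rw [← key]; simp [hf])

/-- The longest common segments of two unique routings form a crossing pattern. -/
theorem exists_crossingPattern (ho : N.IsTopOrder ord) (hp : N.IsUniqueRouting c p)
    (hq : N.IsUniqueRouting d q) (hcd : c ≠ d) :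
    ∃ σ, CrossingPattern (fun a b s => N.IsLCS {p a, q b} s) (fun s => ord s.1) σ := by
  have comm : ∀ (a b : Fin k) (s : N.V × List N.A),
      N.IsLCS {q b, p a} s = N.IsLCS {p a, q b} s := fun a b s => by rw [Set.pair_comm]
  have hsrc : ∀ a, ∃ s, N.IsLCS {p a, q a} s ∧ N.SegLE (N.src a, []) s := fun a => by
    have on : ∀ {l : List N.A}, N.src a ∈ N.pathVerts l → N.SegOn (N.src a, []) l := fun h =>
      ⟨List.nil_infix, h⟩
    exact exists_isLCS (IsWalk.isSeg (v := N.src a) rfl) (on (hp.path a).start_mem)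
      (on (hq.path a).start_mem)
  choose σ hσ hle using hsrc
  have ord_src : ∀ {a e : Fin k} {l : List N.A} {s : N.V × List N.A},
      N.IsPathFrom (N.src a) (N.snk e) l → N.SegOn s l → ord (σ a).1 ≤ ord s.1 := by
    intro a e l s hl hs
    obtain ⟨_, _, -, h, -⟩ := hl.mem_pathVerts.1 hs.2
    exact ((isLCS_pair.1 (hσ a)).1.ord_start_le ho (segVerts_mono (hle a) (start_mem _))).trans
      (h.ord_le ho)
  refine ⟨σ, ?_, ?_, fun h h' e => lcs_eq_of_ord_eq ho hp hq hcd h h' e, hσ,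
    fun h => ord_src (hp.path _) (isLCS_pair.1 h).2.1,
    fun h => ord_src (hq.path _) (isLCS_pair.1 h).2.2.1,
    fun h h' => not_colNext ho hp hq hcd h h', ?_,
    fun ha h₁ h₂ h₃ h₄ h₅ h₆ h₇ h₈ => no_switch ho hp hq hcd ha h₁ h₂ h₃ h₄ h₅ h₆ h₇ h₈, ?_⟩
  · intro a b a' b' s h h'
    have := isLCS_pair.1 h'
    exact ⟨row_eq ho hp hq hcd h (start_mem s) this.2.1.2,
      col_eq ho hp hq hcd h (start_mem s) this.2.2.1.2⟩
  · intro a b b' s s' h h' e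
    simp only [← comm] at h h'
    exact lcs_eq_of_ord_eq ho hq hp hcd.symm h h' e
  · intro a b y x h h'
    simp only [← comm] at h h' ⊢
    exact not_colNext ho hq hp hcd.symm h h'
  · intro a a' b b' y x y' x' hb h₁ h₂ h₃ h₄ h₅ h₆ h₇ h₈
    simp only [← comm] at h₁ h₂ h₃ h₄ h₅ h₆
    exact no_switch ho hq hp hcd.symm hb h₁ h₂ h₃ h₄ h₅ h₆ h₇ h₈

end IsUniqueRouting
end Routing
end KPairNetwork

namespace KPairNetwork

section Enumeration

variable {k : ℕ} {N : KPairNetwork k} {P : Fin k → Fin k → List N.A} {ord : N.V → ℕ}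
  {c d a b : Fin k} {p : List N.A} {s t : N.V × List N.A}

theorem isPairLCSOn_row_iff (ho : N.IsTopOrder ord) (hP : N.IsStableSystem P) (hcd : c ≠ d) :
    N.IsPairLCSOn P c d (P a c) s ↔ ∃ b, N.IsLCS {P a c, P b d} s := by
  constructor
  · rintro ⟨⟨i, b, hs⟩, hon⟩
    obtain rfl := IsUniqueRouting.row_eq ho (hP.isUniqueRouting c) (hP.isUniqueRouting d) hcd
      hs (start_mem s) hon.2
    exact ⟨b, hs⟩
  · rintro ⟨b, hs⟩
    exact ⟨⟨a, b, hs⟩, (isLCS_pair.1 hs).2.1⟩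

theorem isPairLCSOn_col_iff (ho : N.IsTopOrder ord) (hP : N.IsStableSystem P) (hcd : c ≠ d) :
    N.IsPairLCSOn P c d (P b d) s ↔ ∃ a, N.IsLCS {P a c, P b d} s := by
  constructor
  · rintro ⟨⟨a, i, hs⟩, hon⟩
    obtain rfl := IsUniqueRouting.col_eq ho (hP.isUniqueRouting c) (hP.isUniqueRouting d) hcd
      hs (start_mem s) hon.2
    exact ⟨a, hs⟩
  · rintro ⟨a, hs⟩
    exact ⟨⟨a, b, hs⟩, (isLCS_pair.1 hs).2.2.1⟩

theorem eq_of_lcsCount_eq_one (h : N.lcsCount P c d p = 1) (hs : N.IsPairLCSOn P c d p s)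
    (ht : N.IsPairLCSOn P c d p t) : s = t := by
  have := (Nat.card_eq_one_iff_unique.1 h).1
  exact congrArg Subtype.val (Subsingleton.elim
    (⟨s, hs⟩ : {s : N.V × List N.A | N.IsPairLCSOn P c d p s}) ⟨t, ht⟩)

theorem lcsCount_eq_one (hs : N.IsPairLCSOn P c d p s)
    (h : ∀ t, N.IsPairLCSOn P c d p t → t = s) : N.lcsCount P c d p = 1 :=
  Nat.card_eq_one_iff_unique.2
    ⟨⟨fun x y => Subtype.ext ((h x x.2).trans (h y y.2).symm)⟩, ⟨⟨s, hs⟩⟩⟩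

theorem StrictlyBeforeOn.ord_lt (ho : N.IsTopOrder ord) {u v x y : N.V}
    (hp : N.IsPathFrom u v p) (h : N.StrictlyBeforeOn p x y) : ord x < ord y := by
  obtain ⟨l, hl, hx, hy⟩ := h
  have hne : l ≠ [] := by
    rintro rfl
    simp at hx
  obtain ⟨L, R, rfl⟩ := hl
  obtain ⟨z, hz, -⟩ := isWalk_append.1 hp.isWalk
  obtain ⟨w, -, hw⟩ := isWalk_append.1 hz
  obtain ⟨-, h₁, h₂⟩ := isWalk_iff.1 hw
  obtain ⟨e, he, rfl⟩ := Option.map_eq_some_iff.1 hx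
  obtain ⟨f, hf, rfl⟩ := Option.map_eq_some_iff.1 hy
  have := hw.ord_lt ho hne
  rw [hf] at h₂
  rw [h₁ e he]
  exact (show N.head f = z from h₂) ▸ this

theorem IsLCSEnum.isColEnum (ho : N.IsTopOrder ord) {u v : N.V} {e : ℕ → N.V × List N.A} {L : ℕ}
    {C : Fin k → Fin k → N.V × List N.A → Prop} (he : N.IsLCSEnum P c d p e L)
    (hp : N.IsPathFrom u v p) (hC : ∀ s, N.IsPairLCSOn P c d p s ↔ ∃ a, C a b s) :
    IsColEnum C (fun s => ord s.1) b e L where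
  mem n hn := (hC _).1 (he.1 n hn)
  surj a s hs := he.2.1 s ((hC s).2 ⟨a, hs⟩)
  lt m n hmn hn := by
    obtain ⟨⟨i, i', hs⟩, -⟩ := he.1 m (hmn.trans hn)
    exact ((isLCS_pair.1 hs).1.ord_le_end ho (start_mem _)).trans_lt
      ((he.2.2 m n hmn hn).ord_lt ho hp)

end Enumeration
end KPairNetwork

/-- Corollary 2 of the paper: if `N_{t₁,t₂}` is
non-degenerated, with `ℓ(r_i) = ℓ(g_l) = 1` (each uniquely so, and `i ≠ l`),
and `j` is the third index, then
(1) `g_i(2) ≠ r_l(2)`;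
(2) there is exactly one `{g_i, r_j}`-l.c.s. and exactly one `{g_j, r_l}`-l.c.s.;
(3) one of (a) `g_i(2) = r_j(2)` and `g_j(2) = r_l(2)`, (b) `g_i(2) = r_j(2)`
and `g_j(2) = r_l(3)`, (c) `g_i(3) = r_j(2)` and `g_j(2) = r_l(2)` holds.
Here `eGi, eGj, eRj, eRl` enumerate (0-based, in order along the path) the
l.c.s.'s lying on `g_i, g_j, r_j, r_l` respectively. -/
theorem statement6 (N : KPairNetwork 3) (P : Fin 3 → Fin 3 → List N.A)
    (hP : N.IsStableSystem P)
    (i j l : Fin 3) (hij : i ≠ j) (hil : i ≠ l) (hjl : j ≠ l)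
    (hri : N.lcsCount P 0 1 (P i 0) = 1)
    (hgl : N.lcsCount P 0 1 (P l 1) = 1)
    (hriU : ∀ i' : Fin 3, N.lcsCount P 0 1 (P i' 0) = 1 → i' = i)
    (hglU : ∀ l' : Fin 3, N.lcsCount P 0 1 (P l' 1) = 1 → l' = l)
    (eGi eGj eRj eRl : ℕ → N.V × List N.A) (LGi LGj LRj LRl : ℕ)
    (heGi : N.IsLCSEnum P 0 1 (P i 1) eGi LGi)
    (heGj : N.IsLCSEnum P 0 1 (P j 1) eGj LGj)
    (heRj : N.IsLCSEnum P 0 1 (P j 0) eRj LRj)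
    (heRl : N.IsLCSEnum P 0 1 (P l 0) eRl LRl) :
    (2 ≤ LGi ∧ 2 ≤ LRl ∧ eGi 1 ≠ eRl 1) ∧
    ((∃! s : N.V × List N.A, N.IsLCS {P i 1, P j 0} s) ∧
      ∃! s : N.V × List N.A, N.IsLCS {P j 1, P l 0} s) ∧
    ((2 ≤ LGi ∧ 2 ≤ LRj ∧ 2 ≤ LGj ∧ 2 ≤ LRl ∧ eGi 1 = eRj 1 ∧ eGj 1 = eRl 1) ∨
     (2 ≤ LGi ∧ 2 ≤ LRj ∧ 2 ≤ LGj ∧ 3 ≤ LRl ∧ eGi 1 = eRj 1 ∧ eGj 1 = eRl 2) ∨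
     (3 ≤ LGi ∧ 2 ≤ LRj ∧ 2 ≤ LGj ∧ 2 ≤ LRl ∧ eGi 2 = eRj 1 ∧ eGj 1 = eRl 1)) := by
  obtain ⟨ord, ho⟩ := N.acyclic
  set p := fun a => P a 0
  set q := fun b => P b 1
  have hp : N.IsUniqueRouting 0 p := hP.isUniqueRouting 0
  have hq : N.IsUniqueRouting 1 q := hP.isUniqueRouting 1
  have h01 : (0 : Fin 3) ≠ 1 := by decide
  obtain ⟨σ, h⟩ := hp.exists_crossingPattern ho hq h01
  have hrow := fun a s => KPairNetwork.isPairLCSOn_row_iff (a := a) (s := s) ho hP h01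
  have hcol := fun b s => KPairNetwork.isPairLCSOn_col_iff (b := b) (s := s) ho hP h01
  have hn : CrossingPattern.IsNondegenerate (fun a b s => N.IsLCS {p a, q b} s) σ i j l := by
    refine ⟨hij, hil, hjl, fun b s hs => ?_, fun a s hs => ?_, ?_, ?_⟩
    · exact KPairNetwork.eq_of_lcsCount_eq_one hri ((hrow i s).2 ⟨b, hs⟩)
        ((hrow i _).2 ⟨i, h.source i⟩)
    · exact KPairNetwork.eq_of_lcsCount_eq_one hgl ((hcol l s).2 ⟨a, hs⟩)
        ((hcol l _).2 ⟨l, h.source l⟩)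
    · by_contra! hs
      refine hij.symm (hriU j (KPairNetwork.lcsCount_eq_one ((hrow j _).2 ⟨j, h.source j⟩) ?_))
      exact fun s hs' => let ⟨b, hb⟩ := (hrow j s).1 hs'; hs b s hb
    · by_contra! hs
      refine hjl (hglU j (KPairNetwork.lcsCount_eq_one ((hcol j _).2 ⟨j, h.source j⟩) ?_))
      exact fun s hs' => let ⟨b, hb⟩ := (hcol j s).1 hs'; hs b s hb
  have := h.classification hn (heGi.isColEnum ho (hP.1.1 i 1) (hcol i))
    (heGj.isColEnum ho (hP.1.1 j 1) (hcol j))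
    (heRj.isColEnum ho (hP.1.1 j 0) (hrow j)) (heRl.isColEnum ho (hP.1.1 l 0) (hrow l))
  simpa only [Set.pair_comm (P i 1), Set.pair_comm (P j 1)] using this
end

section
/- Every stable 3-pair network N has a linear routing solution: there exist reals c^{(l)}_{i,j} (1 ≤ i,j,l ≤ 3) such that the multi-flow (f_1, f_2, f_3) with f_l := Σ_{i,j=1}^3 c^{(l)}_{i,j} f_{i,j} is feasible and has rate (1,1,1). -/
open scoped BigOperators

namespace List

variable {α : Type*}

/-- `a` lies on a common prefix of `p` and `q`. -/
def MemCommonPrefix (p q : List α) (a : α) : Prop :=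
  ∃ s, s <+: p ∧ s <+: q ∧ a ∈ s

theorem MemCommonPrefix.symm {p q : List α} {a : α} (h : MemCommonPrefix p q a) :
    MemCommonPrefix q p a := by
  obtain ⟨s, hp, hq, ha⟩ := h
  exact ⟨s, hq, hp, ha⟩

/-- Elements on which `q` shares initial segments with `p` and with `r` are nested. -/
theorem MemCommonPrefix.mem_or_mem {p q r : List α} {a b : α} (ha : MemCommonPrefix q p a)
    (hb : MemCommonPrefix q r b) : a ∈ r ∨ b ∈ p := by
  obtain ⟨s, hsq, hsp, has⟩ := ha
  obtain ⟨s', hsq', hsr, hbs⟩ := hb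
  rcases List.prefix_or_prefix_of_prefix hsq hsq' with h | h
  · exact .inl (hsr.subset (h.subset has))
  · exact .inr (hsp.subset (h.subset hbs))

/-- If `B` has an element satisfying `X` off the common prefix of `B` and `R`, then `B` leaves `R`
and afterwards has a first element satisfying `X`. -/
theorem exists_departure (X : α → Prop) {B : List α} : ∀ {R : List α},
    (∃ a ∈ B, X a ∧ ¬ MemCommonPrefix B R a) →
    ∃ p d x t r, B = p ++ d ++ x :: t ∧ R = p ++ r ∧ X x ∧ (∀ y ∈ d, ¬ X y) ∧
      (d ++ x :: t).head? ≠ r.head? := by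
  classical
  induction B with
  | nil => rintro R ⟨a, ha, -⟩; simp at ha
  | cons b B ih =>
    rintro R ⟨a, ha, hX, hR⟩
    by_cases hb : R.head? = some b
    · obtain ⟨R', rfl⟩ := List.head?_eq_some_iff.1 hb
      have hab : a ≠ b := by
        rintro rfl
        exact hR ⟨[a], by simp, by simp, by simp⟩
      have haB : a ∈ B := by simpa [hab] using ha
      obtain ⟨p, d, x, t, r, rfl, rfl, h⟩ := ih (R := R') ⟨a, haB, hX, by
        rintro ⟨s, hs, hs', has⟩
        exact hR ⟨b :: s, by simpa using hs, by simpa using hs', by simp [has]⟩⟩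
      exact ⟨b :: p, d, x, t, r, by simp, by simp, h⟩
    · obtain ⟨x, hx⟩ := Option.isSome_iff_exists.1
        (List.find?_isSome (p := fun y => decide (X y)) (xs := b :: B) |>.2 ⟨a, ha, by simpa⟩)
      obtain ⟨hXx, d, t, hdt, hd⟩ := List.find?_eq_some_iff_append.1 hx
      refine ⟨[], d, x, t, R, by simpa using hdt, rfl, by simpa using hXx,
        fun y hy => by simpa using hd y hy, ?_⟩
      rw [← hdt]
      exact fun h => hb h.symm

theorem MemCommonPrefix.mono {p p' q : List α} {a : α} (h : MemCommonPrefix p q a)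
    (hp : p <+: p') : MemCommonPrefix p' q a := by
  obtain ⟨s, hs, hq, ha⟩ := h
  exact ⟨s, hs.trans hp, hq, ha⟩

theorem MemCommonPrefix.mem_right {p q : List α} {a : α} (h : MemCommonPrefix p q a) : a ∈ q := by
  obtain ⟨s, -, hq, ha⟩ := h
  exact hq.subset ha

/-- Elements of a common prefix are preceded by a common prefix. -/
theorem MemCommonPrefix.concat_isPrefix {l₁ l₂ q : List α} {m y : α}
    (h : MemCommonPrefix (l₁ ++ m :: l₂) q y) (hnd : (l₁ ++ m :: l₂).Nodup) (hy : y ∈ m :: l₂) :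
    l₁ ++ [m] <+: q := by
  obtain ⟨s, hs, hq, hys⟩ := h
  have hm : l₁ ++ [m] <+: l₁ ++ m :: l₂ := by simp
  rcases List.prefix_or_prefix_of_prefix hs hm with h | h
  · have hyl : y ∉ l₁ := fun h' => (List.nodup_append.1 hnd).2.2 y h' y hy rfl
    have : y = m := by simpa [hyl] using h.subset hys
    subst this
    rcases List.prefix_concat_iff.1 h with h | h
    · rwa [← h]
    · exact absurd (h.subset hys) hyl
  · exact h.trans hq

/-- A list with an element satisfying `X` has a prefix ending with the first such element. -/
theorem exists_concat_isPrefix (X : α → Prop) {l : List α} {a : α} (ha : a ∈ l)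
    (hX : X a) : ∃ d x, d ++ [x] <+: l ∧ X x ∧ ∀ y ∈ d, ¬ X y := by
  classical
  obtain ⟨x, hx⟩ := Option.isSome_iff_exists.1
    (List.find?_isSome (p := fun y => decide (X y)) (xs := l) |>.2 ⟨a, ha, by simpa⟩)
  obtain ⟨hXx, d, t, rfl, hd⟩ := List.find?_eq_some_iff_append.1 hx
  exact ⟨d, x, ⟨t, by simp⟩, by simpa using hXx, fun y hy => by simpa using hd y hy⟩

end List

namespace KPairNetwork

variable {k : ℕ} {N : KPairNetwork k}

/-- Consecutive arcs of a path. -/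
abbrev Consec (N : KPairNetwork k) (a b : N.A) : Prop := N.head a = N.tail b

theorem nodup_of_isChain {l : List N.A} (h : l.IsChain N.Consec) : l.Nodup := by
  obtain ⟨ord, hord⟩ := N.acyclic
  have h₁ : l.IsChain fun a b => ord (N.tail a) < ord (N.tail b) :=
    h.imp fun a b (hab : N.head a = N.tail b) => hab ▸ hord a
  have : Trans (fun a b : N.A => ord (N.tail a) < ord (N.tail b))
      (fun a b : N.A => ord (N.tail a) < ord (N.tail b))
      (fun a b : N.A => ord (N.tail a) < ord (N.tail b)) := ⟨fun h h' => lt_trans h h'⟩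
  exact h₁.pairwise.imp fun {a b} hab => by rintro rfl; exact lt_irrefl _ hab

theorem sum_map_sub_of_isChain (g : N.V → ℝ) : ∀ {l : List N.A} {u v : N.V}, l ≠ [] →
    l.IsChain N.Consec → (∀ a ∈ l.head?, N.tail a = u) → (∀ a ∈ l.getLast?, N.head a = v) →
    (l.map fun a => g (N.head a) - g (N.tail a)).sum = g v - g u
  | [], _, _, h, _, _, _ => absurd rfl h
  | [a], u, v, _, _, hu, hv => by
    have := hu a (by simp)
    have := hv a (by simp)
    simp_all
  | a :: b :: l, u, v, _, hc, hu, hv => by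
    have ha := hu a (by simp)
    rw [List.isChain_cons_cons] at hc
    have ih := sum_map_sub_of_isChain g (l := b :: l) (u := N.head a) (v := v) (by simp) hc.2
      (by simpa using hc.1.symm) (fun c hc' => hv c (by simpa using hc'))
    rw [List.map_cons, List.sum_cons, ih, ha]
    ring

theorem excess_unitFlow {l : List N.A} {u v : N.V} (h : N.IsPathFrom u v l) (w : N.V) :
    N.excess (N.unitFlow l) w = (if v = w then 1 else 0) - if u = w then 1 else 0 := by
  obtain ⟨h₀, hc, hu, hv⟩ := h
  rw [← sum_map_sub_of_isChain (fun x => if x = w then (1 : ℝ) else 0) h₀ hc hu hv,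
    ← List.sum_toFinset _ (nodup_of_isChain hc), excess, ← Finset.sum_sub_distrib]
  rw [← Finset.sum_subset (Finset.subset_univ l.toFinset)]
  · refine Finset.sum_congr rfl fun a ha => ?_
    simp [unitFlow, List.mem_toFinset.1 ha]
  · intro a _ ha
    have : a ∉ l := by simpa using ha
    simp [unitFlow, this]

theorem excess_sum {ι : Type*} (s : Finset ι) (c : ι → ℝ) (f : ι → N.A → ℝ) (w : N.V) :
    N.excess (fun a => ∑ i ∈ s, c i * f i a) w = ∑ i ∈ s, c i * N.excess (f i) w := by
  simp only [excess, ← Finset.sum_sub_distrib, Finset.mul_sum]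
  rw [Finset.sum_comm]
  refine Finset.sum_congr rfl fun a _ => ?_
  split_ifs <;> simp

theorem src_ne_snk {P : Fin k → Fin k → List N.A} (hP : N.IsStrongSystem P) (i j : Fin k) :
    N.src i ≠ N.snk j := by
  obtain ⟨h₀, -, -, hv⟩ := hP.1 i j
  intro h
  exact N.src_no_in i _ ((hv _ (List.getLast?_eq_some_getLast h₀)).trans h.symm)

/-- Stability at one sink: paths from the sources that avoid the old paths of the sources outside
`I` must, for some `i ∈ I`, meet the old paths only on the common prefix of the two paths of `i`. -/
theorem exists_memCommonPrefix {N : KPairNetwork 3} {P : Fin 3 → Fin 3 → List N.A}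
    (hP : N.IsStableSystem P) (j : Fin 3) {I : Finset (Fin 3)} (hI : I.Nonempty)
    {B : Fin 3 → List N.A} (hchain : ∀ i ∈ I, (B i).IsChain N.Consec)
    (hstart : ∀ i ∈ I, ∀ a ∈ (B i).head?, N.tail a = N.src i)
    (hdisj : ∀ i ∈ I, ∀ i' ∈ I, i ≠ i' → ∀ a ∈ B i, a ∉ B i')
    (havoid : ∀ i ∈ I, ∀ i' ∉ I, ∀ a ∈ B i, a ∉ P i' j) :
    ∃ i ∈ I, ∀ i', ∀ a ∈ B i, a ∈ P i' j → List.MemCommonPrefix (B i) (P i j) a := by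
  by_contra! hcon
  have key : ∀ i, ∃ s p d x t r, i ∈ I → B i = p ++ d ++ x :: t ∧ P i j = p ++ r ∧ x ∈ P s j ∧
      (∀ y ∈ d, ∀ i', y ∉ P i' j) ∧ (d ++ x :: t).head? ≠ r.head? := by
    intro i
    by_cases hi : i ∈ I
    · obtain ⟨i', a, haB, haP, ha⟩ := hcon i hi
      obtain ⟨p, d, x, t, r, h₁, h₂, ⟨s, hs⟩, h₃, h₄⟩ :=
        List.exists_departure (fun a => ∃ i', a ∈ P i' j) ⟨a, haB, ⟨i', haP⟩, ha⟩
      exact ⟨s, p, d, x, t, r, fun _ => ⟨h₁, h₂, hs, fun y hy i' h => h₃ y hy ⟨i', h⟩, h₄⟩⟩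
    · obtain ⟨x, -⟩ := List.exists_mem_of_ne_nil _ (hP.1.1 0 j).1
      exact ⟨0, [], [], x, [], [], fun h => absurd h hi⟩
  choose s p d x t r h using key
  have hsI : ∀ i ∈ I, s i ∈ I := by
    intro i hi
    obtain ⟨hB, -, hs, -⟩ := h i hi
    by_contra hsi
    exact havoid i hi _ hsi (x i) (by simp [hB]) hs
  have hxr : ∀ i, ∃ u v, i ∈ I → r (s i) = u ++ x i :: v := by
    intro i
    by_cases hi : i ∈ I
    · obtain ⟨hB, -, hs, -⟩ := h i hi
      obtain ⟨hB', hR', -⟩ := h (s i) (hsI i hi)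
      rw [hR', List.mem_append] at hs
      rcases hs with hs | hs
      · by_cases hsi : s i = i
        · have hnd := nodup_of_isChain (hchain i hi)
          rw [hsi] at hs
          rw [hB, List.append_assoc, List.nodup_append] at hnd
          exact absurd rfl (hnd.2.2 _ hs (x i) (by simp))
        · exact absurd (by simp [hB', hs]) (hdisj i hi _ (hsI i hi) (Ne.symm hsi) (x i)
            (by simp [hB]))
      · obtain ⟨u, v, huv⟩ := List.append_of_mem hs
        exact ⟨u, v, fun _ => huv⟩
    · exact ⟨[], [], fun h => absurd h hi⟩
  choose u v huv using hxr
  obtain ⟨C, hCI, ⟨i₀, hi₀⟩, hCs, hCinj⟩ : ∃ C ⊆ I, C.Nonempty ∧ (∀ i ∈ C, s i ∈ C) ∧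
      ∀ i ∈ C, ∀ i' ∈ C, s i = s i' → i = i' := by
    clear * - hsI hI
    revert s I
    decide +kernel
  have hPs : ∀ i ∈ C, P (s i) j = p (s i) ++ u i ++ x i :: v i := by
    intro i hi
    rw [(h _ (hsI i (hCI hi))).2.1, huv i (hCI hi)]
    simp
  have hQ := hP.2 j (fun i => if i ∈ C then p i ++ d i ++ x i :: v i else P i j) ?_ ?_ i₀
  · simp only [hi₀, if_true] at hQ
    obtain ⟨-, hR, -, -, hne⟩ := h i₀ (hCI hi₀)
    rw [hR, List.append_assoc, List.append_cancel_left_eq] at hQ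
    apply hne
    rw [← hQ]
    cases d i₀ <;> simp
  · intro i
    by_cases hi : i ∈ C
    · obtain ⟨hB, hR, -, -, -⟩ := h i (hCI hi)
      have hc := hchain i (hCI hi)
      have hst := hstart i (hCI hi)
      obtain ⟨-, hc', -, hend⟩ := hP.1.1 (s i) j
      change List.IsChain N.Consec _ at hc'
      rw [hPs i hi] at hc' hend
      rw [hB] at hc hst
      simp only [hi, if_true]
      refine ⟨by simp, ?_, ?_, ?_⟩
      · change List.IsChain N.Consec _
        rw [List.isChain_append] at hc hc' ⊢
        exact ⟨hc.1, hc'.2.1, by simpa using hc.2.2⟩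
      · intro a ha
        apply hst a
        cases hp : p i ++ d i <;> simp_all
      · intro a ha
        apply hend a
        simpa [List.getLast?_append] using ha
    · simp only [hi, if_false]
      exact hP.1.1 i j
  · have hmem : ∀ i ∈ C, ∀ a ∈ p i ++ d i ++ x i :: v i, a ∈ p i ∨ a ∈ d i ∨ a ∈ x i :: v i := by
      intro i _ a ha
      simpa [or_assoc] using ha
    have hpP : ∀ i ∈ C, ∀ a ∈ p i, a ∈ P i j := fun i hi a ha => by
      rw [(h i (hCI hi)).2.1]; simp [ha]
    have hvP : ∀ i ∈ C, ∀ a ∈ x i :: v i, a ∈ P (s i) j := fun i hi a ha => by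
      rw [hPs i hi]; exact List.mem_append_right _ ha
    have hdB : ∀ i ∈ C, ∀ a ∈ d i, a ∈ B i := fun i hi a ha => by
      rw [(h i (hCI hi)).1]; simp [ha]
    have hdP : ∀ i ∈ C, ∀ a ∈ d i, ∀ i', a ∉ P i' j := fun i hi => (h i (hCI hi)).2.2.2.1
    have hpv : ∀ i ∈ C, ∀ i' ∈ C, i ≠ i' → ∀ a ∈ p i, a ∉ x i' :: v i' := by
      intro i hi i' hi' _ a ha ha'
      by_cases hs : s i' = i
      · have hnd := nodup_of_isChain (hP.1.1 (s i') j).2.1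
        rw [hPs i' hi', hs, List.append_assoc, List.nodup_append] at hnd
        exact hnd.2.2 a ha a (List.mem_append_right _ ha') rfl
      · exact hP.1.2 j _ _ hs a (hvP i' hi' a ha') (hpP i hi a ha)
    intro i i' hii' a ha ha'
    by_cases hi : i ∈ C <;> by_cases hi' : i' ∈ C <;>
      simp only [hi, hi', if_true, if_false] at ha ha'
    · rcases hmem i hi a ha with h₁ | h₁ | h₁ <;> rcases hmem i' hi' a ha' with h₂ | h₂ | h₂
      · exact hP.1.2 j i i' hii' a (hpP i hi a h₁) (hpP i' hi' a h₂)
      · exact hdP i' hi' a h₂ i (hpP i hi a h₁)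
      · exact hpv i hi i' hi' hii' a h₁ h₂
      · exact hdP i hi a h₁ i' (hpP i' hi' a h₂)
      · exact hdisj i (hCI hi) i' (hCI hi') hii' a (hdB i hi a h₁) (hdB i' hi' a h₂)
      · exact hdP i hi a h₁ _ (hvP i' hi' a h₂)
      · exact hpv i' hi' i hi hii'.symm a h₂ h₁
      · exact hdP i' hi' a h₂ _ (hvP i hi a h₁)
      · exact hP.1.2 j _ _ (fun hs => hii' (hCinj i hi i' hi' hs)) a (hvP i hi a h₁)
          (hvP i' hi' a h₂)
    · rcases hmem i hi a ha with h₁ | h₁ | h₁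
      · exact hP.1.2 j i i' hii' a (hpP i hi a h₁) ha'
      · exact hdP i hi a h₁ i' ha'
      · exact hP.1.2 j (s i) i' (fun hs => hi' (hs ▸ hCs i hi)) a (hvP i hi a h₁) ha'
    · rcases hmem i' hi' a ha' with h₁ | h₁ | h₁
      · exact hP.1.2 j i i' hii' a ha (hpP i' hi' a h₁)
      · exact hdP i' hi' a h₁ i ha
      · exact hP.1.2 j (s i') i (fun hs => hi (hs ▸ hCs i' hi')) a (hvP i' hi' a h₁) ha
    · exact hP.1.2 j i i' hii' a ha ha'

end KPairNetwork

namespace RoutingTable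

/-- Rank of `i` in the linear order on `Fin 3` with minimum `e.1` and maximum `e.2`. -/
def rank (e : Fin 3 × Fin 3) (i : Fin 3) : ℕ :=
  if i = e.1 then 0 else if i = e.2 then 2 else 1

/-- The possible pairs of a minimum and a maximum of a linear order on `Fin 3`. -/
def orders : List (Fin 3 × Fin 3) := [(0, 1), (0, 2), (1, 0), (1, 2), (2, 0), (2, 1)]

/-- Whether a path from source `i` to sink `j` may share an arc with a path from source `i'` to sink
`j'`, where `o q` is the order of the sources with respect to the sinks `q + 1` and `q + 2`. -/
def MayMeet (o : Fin 3 → Fin 3 × Fin 3) (i j i' j' : Fin 3) : Prop :=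
  if j' = j + 1 then rank (o (j + 2)) i ≤ rank (o (j + 2)) i'
  else if j = j' + 1 then rank (o (j' + 2)) i' ≤ rank (o (j' + 2)) i
  else i = i'

instance (o : Fin 3 → Fin 3 × Fin 3) (i j i' j' : Fin 3) : Decidable (MayMeet o i j i' j') := by
  unfold MayMeet; infer_instance

/-- Integral coefficients of routing solutions, multiplied by `24`. -/
def table : List (List (List (List ℤ))) := [
  [[[12, 6, 6], [6, -6, 0], [6, 0, -6]], [[-6, 6, 0], [6, 12, 6], [0, 6, -6]],
    [[-6, 0, 6], [0, -6, 6], [6, 6, 12]]],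
  [[[18, 0, 6], [0, 0, 0], [6, 0, -6]], [[0, 0, 0], [0, 18, 6], [0, 6, -6]],
    [[-6, 0, 6], [0, -6, 6], [6, 6, 12]]],
  [[[24, 0, 0], [0, 0, 0], [0, 0, 0]], [[0, 0, 0], [0, 24, 0], [0, 0, 0]],
    [[0, 0, 0], [0, 0, 0], [0, 0, 24]]],
  [[[18, 0, 6], [0, 0, 0], [6, 0, -6]], [[0, 0, 0], [0, 24, 0], [0, 0, 0]],
    [[-6, 0, 6], [0, 0, 0], [6, 0, 18]]],
  [[[12, 6, 6], [0, 0, 0], [12, -6, -6]], [[-6, 6, 0], [6, 12, 6], [0, 6, -6]],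
    [[-6, 0, 6], [-6, 0, 6], [12, 0, 12]]],
  [[[14, 6, 4], [2, 0, -2], [8, -6, -2]], [[-6, 6, 0], [6, 18, 0], [0, 0, 0]],
    [[-4, 0, 4], [-4, -6, 10], [8, 6, 10]]],
  [[[15, 12, -3], [9, -9, 0], [0, -3, 3]], [[-3, 0, 3], [9, 15, 0], [-6, 9, -3]],
    [[-6, -12, 18], [0, 0, 0], [6, 12, 6]]]]

/-- The permutation of `Fin 3` sending `0` to `e.1` and `1` to `e.2`, where `e.1 ≠ e.2`. -/
def permute (e : Fin 3 × Fin 3) (i : Fin 3) : Fin 3 :=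
  if i = 0 then e.1 else if i = 1 then e.2 else -(e.1 + e.2)

/-- The coefficients of a routing solution from the table after relabelling the pairs. -/
def coeff (T : List (List (List ℤ))) (e : Fin 3 × Fin 3) (l i j : Fin 3) : ℤ :=
  (((T.getD (permute e l) []).getD (permute e i) []).getD (permute e j) 0)

/-- The summand for a sink, given the source whose path to that sink uses the arc. -/
def term (c : Fin 3 → Fin 3 → ℤ) (x : Option (Fin 3)) (j : Fin 3) : ℤ :=
  x.elim 0 fun i => c i j

/-- The load of an arc that lies on the paths from `x`, `y`, `z` to the sinks `0`, `1`, `2`. -/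
def load (c : Fin 3 → Fin 3 → Fin 3 → ℤ) (x y z : Option (Fin 3)) : ℕ :=
  (term (c 0) x 0 + term (c 0) y 1 + term (c 0) z 2).natAbs +
  (term (c 1) x 0 + term (c 1) y 1 + term (c 1) z 2).natAbs +
  (term (c 2) x 0 + term (c 2) y 1 + term (c 2) z 2).natAbs

/-- Compatibility of the sources `x`, `y` of the paths through an arc to the sinks `q + 1`, `q + 2`,
where `z` is the source of the path to the sink `q` and `(i, q) ∈ m` means that no arc lies on the
paths from `i` to the sinks `q + 1` and `q + 2` but off the path from `i` to `q`. -/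
def Compatible (o : Fin 3 → Fin 3 × Fin 3) (m : List (Fin 3 × Fin 3)) (q : Fin 3)
    (x y z : Option (Fin 3)) : Bool :=
  match x, y with
  | some i, some i' => decide (rank (o q) i ≤ rank (o q) i') &&
      !(decide (i = i') && decide (z ≠ some i) && decide ((i, q) ∈ m))
  | _, _ => true

def options : List (Option (Fin 3)) := [some 0, some 1, some 2, none]

/-- The triples of sources compatible with the orders `o` and the exclusions `m`. -/
def patterns (o : Fin 3 → Fin 3 × Fin 3) (m : List (Fin 3 × Fin 3)) :
    List (Option (Fin 3) × Option (Fin 3) × Option (Fin 3)) :=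
  (options ×ˢ options ×ˢ options).filter fun s =>
    Compatible o m 2 s.1 s.2.1 s.2.2 && Compatible o m 0 s.2.1 s.2.2 s.1 &&
      Compatible o m 1 s.2.2 s.1 s.2.1

/-- Some tabulated solution is feasible for all patterns compatible with `o` and `m`. -/
def solvable (o : Fin 3 → Fin 3 × Fin 3) (m : List (Fin 3 × Fin 3)) : Bool :=
  table.any fun T => orders.any fun e =>
    (patterns o m).all fun s => decide (load (coeff T e) s.1 s.2.1 s.2.2 ≤ 24)

/-- Case analysis over a list of clauses, each of which provides one more exclusion. -/
def solvableByCases (o : Fin 3 → Fin 3 × Fin 3) :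
    List (List (Fin 3 × Fin 3)) → List (Fin 3 × Fin 3) → Bool
  | [], m => solvable o m
  | cl :: cls, m => solvable o m || cl.all fun b => solvableByCases o cls (b :: m)

/-- Situation in which an exchange at the sink `j` of the sources `u` and `v` leads to an
exclusion. -/
def Exchangeable (o : Fin 3 → Fin 3 × Fin 3) (j k k' u v w : Fin 3) : Prop :=
  ¬ MayMeet o u k w j ∧ ¬ MayMeet o v k' w j ∧ rank (o k) u ≠ 1 ∧ rank (o j) v ≠ 1

instance (o : Fin 3 → Fin 3 × Fin 3) (j k k' u v w : Fin 3) :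
    Decidable (Exchangeable o j k k' u v w) := by
  unfold Exchangeable; infer_instance

def arrangements : List (Fin 3 × Fin 3 × Fin 3) :=
  [(0, 1, 2), (0, 2, 1), (1, 0, 2), (1, 2, 0), (2, 0, 1), (2, 1, 0)]

/-- Clauses coming from nested common prefixes. -/
def nestedClauses (o : Fin 3 → Fin 3 × Fin 3) : List (List (Fin 3 × Fin 3)) :=
  [0, 1, 2].flatMap fun i : Fin 3 => [0, 1, 2].filterMap fun q : Fin 3 =>
    if rank (o q) i ≠ 1 ∧ rank (o (q + 1)) i ≠ 1 then some [(i, q), (i, q + 1)] else none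

/-- Clauses coming from exchanges between two sources. -/
def exchangeClauses (o : Fin 3 → Fin 3 × Fin 3) : List (List (Fin 3 × Fin 3)) :=
  arrangements.flatMap fun (j, k, k') => arrangements.filterMap fun (u, v, w) =>
    if Exchangeable o j k k' u v w then some [(u, k), (v, j), (u, k'), (v, k)] else none

theorem solvableByCases_clauses : ∀ e₀ ∈ orders, ∀ e₁ ∈ orders, ∀ e₂ ∈ orders,
    solvableByCases ![e₀, e₁, e₂]
      (nestedClauses ![e₀, e₁, e₂] ++ exchangeClauses ![e₀, e₁, e₂]) [] = true := by
  decide +kernel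

theorem solvableByCases_of_mem_orders {o : Fin 3 → Fin 3 × Fin 3} (ho : ∀ q, o q ∈ orders) :
    solvableByCases o (nestedClauses o ++ exchangeClauses o) [] = true := by
  have h : ![o 0, o 1, o 2] = o := by
    ext q : 1
    fin_cases q <;> rfl
  have hs := solvableByCases_clauses _ (ho 0) _ (ho 1) _ (ho 2)
  rwa [h] at hs

theorem exists_solvable {o : Fin 3 → Fin 3 × Fin 3} {E : Fin 3 × Fin 3 → Prop} :
    ∀ {cls m}, solvableByCases o cls m = true → (∀ cl ∈ cls, ∃ b ∈ cl, E b) → (∀ b ∈ m, E b) →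
      ∃ m', solvable o m' = true ∧ ∀ b ∈ m', E b
  | [], m, h, _, hm => ⟨m, h, hm⟩
  | cl :: cls, m, h, hcl, hm => by
    rw [solvableByCases, Bool.or_eq_true, List.all_eq_true] at h
    rcases h with h | h
    · exact ⟨m, h, hm⟩
    · obtain ⟨b, hb, hE⟩ := hcl cl (by simp)
      exact exists_solvable (h b hb) (fun c hc => hcl c (by simp [hc])) (by simpa [hE] using hm)

theorem exists_coeff_of_solvable {o : Fin 3 → Fin 3 × Fin 3} {m : List (Fin 3 × Fin 3)}
    (h : solvable o m = true) : ∃ T ∈ table, ∃ e ∈ orders, ∀ x y z, (x, y, z) ∈ patterns o m →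
      load (coeff T e) x y z ≤ 24 := by
  rw [solvable, List.any_eq_true] at h
  obtain ⟨T, hT, h⟩ := h
  rw [List.any_eq_true] at h
  obtain ⟨e, he, h⟩ := h
  rw [List.all_eq_true] at h
  exact ⟨T, hT, e, he, fun x y z hs => of_decide_eq_true (h _ hs)⟩

theorem sum_coeff : ∀ T ∈ table, ∀ e ∈ orders,
    (∀ l i, ∑ j, coeff T e l i j = if i = l then 24 else 0) ∧
      ∀ l j, ∑ i, coeff T e l i j = if j = l then 24 else 0 := by
  decide +kernel

theorem mem_options (x : Option (Fin 3)) : x ∈ options := by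
  revert x; decide

/-- A choice of a minimum and a maximum from two exchange principles. -/
theorem exists_order (M : Fin 3 → Fin 3 → Prop) (E : Fin 3 → Prop)
    (h₁ : ∀ I : Finset (Fin 3), I.Nonempty → (∀ i ∈ I, ∀ i' ∉ I, ¬ M i' i) →
      ∃ i ∈ I, (∀ i', M i' i → i' = i) ∧ E i)
    (h₂ : ∀ I : Finset (Fin 3), I.Nonempty → (∀ i ∈ I, ∀ i' ∉ I, ¬ M i i') →
      ∃ i ∈ I, (∀ i', M i i' → i' = i) ∧ E i) :
    ∃ e ∈ orders, (∀ i i', M i i' → rank e i ≤ rank e i') ∧ ∀ i, rank e i ≠ 1 → E i := by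
  have horders : ∀ a b : Fin 3, a ≠ b → (a, b) ∈ orders := by decide
  have hsucc : ∀ a : Fin 3, a + 1 ∈ Finset.univ.erase a := by decide
  have key : ∀ a b, a ≠ b → (∀ i, M i a → i = a) → (∀ i, M b i → i = b) → E a → E b →
      ∃ e ∈ orders, (∀ i i', M i i' → rank e i ≤ rank e i') ∧ ∀ i, rank e i ≠ 1 → E i := by
    intro a b hab ha hb hEa hEb
    refine ⟨(a, b), horders a b hab, fun i i' h => ?_, fun i hi => ?_⟩
    · have h₃ : i' = a → i = a := by rintro rfl; exact ha i h
      have h₄ : i = b → i' = b := by rintro rfl; exact hb i' h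
      simp only [rank]
      split_ifs <;> simp_all
    · simp only [rank] at hi
      split_ifs at hi with h h' <;> simp_all
  obtain ⟨a, -, ha, hEa⟩ := h₁ Finset.univ ⟨0, by simp⟩ (by simp)
  obtain ⟨b, -, hb, hEb⟩ := h₂ Finset.univ ⟨0, by simp⟩ (by simp)
  by_cases hab : a = b
  · subst hab
    obtain ⟨c, hc, hc', hEc⟩ := h₁ (Finset.univ.erase a)
      ⟨a + 1, hsucc a⟩ (fun i hi i' hi' hM => by
        have : i' = a := by simpa using hi'
        subst this
        exact (Finset.ne_of_mem_erase hi) (hb i hM))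
    exact key c a (Finset.ne_of_mem_erase hc) hc' hb hEc hEa
  · exact key a b hab ha hb hEa hEb

end RoutingTable

namespace KPairNetwork

open RoutingTable

variable {N : KPairNetwork 3} {P : Fin 3 → Fin 3 → List N.A}

/-- Some arc lies on the paths from source `i` to all sinks but `q`. -/
def MissesOnly (P : Fin 3 → Fin 3 → List N.A) (i q : Fin 3) : Prop :=
  ∃ a, ∀ j, a ∈ P i j ↔ j ≠ q

theorem not_missesOnly_or_of_nested {i q q' r : Fin 3} (hq : q ≠ q') (hr : r ≠ q) (hr' : r ≠ q')
    (h : ∀ a ∈ P i r, a ∈ P i q → List.MemCommonPrefix (P i r) (P i q) a)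
    (h' : ∀ a ∈ P i r, a ∈ P i q' → List.MemCommonPrefix (P i r) (P i q') a) :
    ¬ MissesOnly P i q ∨ ¬ MissesOnly P i q' := by
  by_contra! hcon
  obtain ⟨⟨a, ha⟩, ⟨b, hb⟩⟩ := hcon
  rcases (h' a ((ha r).2 hr) ((ha q').2 hq.symm)).mem_or_mem
    (h b ((hb r).2 hr') ((hb q).2 hq)) with hc | hc
  · exact (ha q).1 hc rfl
  · exact (hb q').1 hc rfl

theorem IsStableSystem.isChain (hP : N.IsStableSystem P) (i j : Fin 3) :
    (P i j).IsChain N.Consec :=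
  (hP.1.1 i j).2.1

theorem IsStableSystem.eq_of_mem (hP : N.IsStableSystem P) {i i' j : Fin 3} {a : N.A}
    (h : a ∈ P i j) (h' : a ∈ P i' j) : i = i' := by
  by_contra hne
  exact hP.1.2 j i i' hne a h h'

theorem IsStableSystem.tail_of_isPrefix (hP : N.IsStableSystem P) {i j : Fin 3} {l : List N.A}
    (hl : l <+: P i j) : ∀ a ∈ l.head?, N.tail a = N.src i := by
  obtain ⟨t, ht⟩ := hl
  intro a ha
  refine (hP.1.1 i j).2.2.1 a ?_
  rw [← ht]
  cases l <;> simp_all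

/-- An initial segment ending with the first arc on old paths off the common prefix. -/
theorem IsStableSystem.exists_first_arc (hP : N.IsStableSystem P) {j k u w : Fin 3}
    (hw : ∀ a ∈ P u k, a ∉ P w j) {a : N.A} (ha : a ∈ P u k) (ha' : a ∈ P u j)
    (hpre : ¬ List.MemCommonPrefix (P u k) (P u j) a) :
    ∃ d x s, d ++ [x] <+: P u k ∧ x ∈ P s j ∧ s ≠ u ∧ s ≠ w ∧
      ¬ List.MemCommonPrefix (P u k) (P u j) x ∧
      ∀ y ∈ d, ∀ i, y ∈ P i j → List.MemCommonPrefix (P u k) (P u j) y := by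
  obtain ⟨d, x, hd, ⟨⟨s, hs⟩, hx⟩, hy⟩ := List.exists_concat_isPrefix
    (fun a => (∃ i, a ∈ P i j) ∧ ¬ List.MemCommonPrefix (P u k) (P u j) a) ha ⟨⟨u, ha'⟩, hpre⟩
  have hy : ∀ y ∈ d, ∀ i, y ∈ P i j → List.MemCommonPrefix (P u k) (P u j) y := fun y hyd i hi =>
    of_not_not fun h => hy y hyd ⟨⟨i, hi⟩, h⟩
  refine ⟨d, x, s, hd, hs, ?_, ?_, hx, hy⟩
  · rintro rfl
    obtain ⟨i, hi, h⟩ := exists_memCommonPrefix hP j (I := {s}) (by simp)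
      (B := fun _ => d ++ [x]) (fun _ _ => (hP.isChain s k).prefix hd)
      (fun i hi => by rw [Finset.mem_singleton.1 hi]; exact hP.tail_of_isPrefix hd)
      (fun i hi i' hi' hne => by simp_all) (fun i hi i' hi' a ha hai' => by
        have hne : i' ≠ s := by simpa using hi'
        rcases List.mem_append.1 ha with ha | ha
        · exact hne (hP.eq_of_mem hai' (hy a ha i' hai').mem_right)
        · rw [List.mem_singleton.1 ha] at hai'
          exact hne (hP.eq_of_mem hai' hs))
    obtain rfl := Finset.mem_singleton.1 hi
    exact hx ((h i x (by simp) hs).mono hd)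
  · rintro rfl
    exact hw x (hd.subset (by simp)) hs

theorem not_missesOnly_or_of_exchange (hP : N.IsStableSystem P) {j k k' u v w : Fin 3}
    (hjk : j ≠ k) (hjk' : j ≠ k') (hkk' : k ≠ k') (huv : u ≠ v) (huw : u ≠ w) (hvw : v ≠ w)
    (hu : ∀ a ∈ P u k, a ∉ P w j) (hv : ∀ a ∈ P v k', a ∉ P w j)
    (hu' : ∀ a ∈ P u j, a ∈ P u k' → List.MemCommonPrefix (P u j) (P u k') a)
    (hv' : ∀ a ∈ P v k', a ∈ P v k → List.MemCommonPrefix (P v k') (P v k) a) :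
    ¬ MissesOnly P u k ∨ ¬ MissesOnly P v j ∨ ¬ MissesOnly P u k' ∨ ¬ MissesOnly P v k := by
  by_contra! hcon
  obtain ⟨⟨e, he⟩, ⟨e', he'⟩, ⟨y, hy⟩, ⟨y', hy'⟩⟩ := hcon
  have hcases : ∀ s : Fin 3, s = u ∨ s = v ∨ s = w := by
    clear * - huv huw hvw
    revert u v w
    decide
  have hpu : ∀ a, List.MemCommonPrefix (P u k) (P u j) a → a ∈ P u k' := fun a ha =>
    (ha.symm.mem_or_mem (hu' e ((he j).2 hjk) ((he k').2 hkk'.symm))).resolve_right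
      fun h => (he k).1 h rfl
  have hpv : ∀ a, List.MemCommonPrefix (P v k') (P v j) a → a ∈ P v k := fun a ha =>
    (ha.mem_or_mem (hv' e' ((he' k').2 hjk'.symm) ((he' k).2 hjk.symm))).resolve_right
      fun h => (he' j).1 h rfl
  obtain ⟨d, x, s, hd, hs, hsu, hsw, hx, hdP⟩ := hP.exists_first_arc hu ((hy k).2 hkk')
    ((hy j).2 hjk') fun h => (hy k').1 (hpu y h) rfl
  obtain ⟨d', x', s', hd', hs', hsv', hsw', hx', hdP'⟩ := hP.exists_first_arc hv
    ((hy' k').2 hkk'.symm) ((hy' j).2 hjk) fun h => (hy' k).1 (hpv y' h) rfl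
  obtain rfl : s = v := by simpa [hsu, hsw] using hcases s
  obtain rfl : s' = u := by simpa [hsv', hsw'] using hcases s'
  by_cases hmeet : ∃ m ∈ d ++ [x], m ∈ d' ++ [x']
  · obtain ⟨m, hm, hm'⟩ := hmeet
    have hmk : m ∉ P s k := fun h => huv (hP.eq_of_mem (hd.subset hm) h)
    have hmk' : m ∉ P s' k' := fun h => huv (hP.eq_of_mem h (hd'.subset hm'))
    obtain ⟨l₁, l₂, hl⟩ := List.append_of_mem hm
    obtain ⟨r₁, r₂, hr⟩ := List.append_of_mem hm'
    have hl' : l₁ ++ [m] <+: d ++ [x] := by rw [hl]; simp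
    have hl₁ : l₁ <+: d := by
      have := (List.prefix_append l₁ (m :: l₂))
      rw [← hl, List.prefix_concat_iff] at this
      refine this.resolve_left fun h => ?_
      rw [h] at hl
      simp at hl
    have hxr : x' ∈ m :: r₂ := by
      have := congrArg List.getLast? hr
      simp only [List.getLast?_append, List.getLast?_singleton, Option.some_or] at this
      refine List.mem_of_getLast? (l := m :: r₂) ?_
      rw [this]
      cases h : (m :: r₂).getLast? <;> simp_all
    have hcd : (d ++ [x]).IsChain N.Consec := (hP.isChain _ _).prefix hd
    have hcd' : (d' ++ [x']).IsChain N.Consec := (hP.isChain _ _).prefix hd'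
    have hchain : (l₁ ++ m :: r₂).IsChain N.Consec := by
      rw [hl] at hcd
      rw [hr] at hcd'
      rw [List.isChain_append] at hcd hcd' ⊢
      exact ⟨hcd.1, hcd'.2.1, by simpa using hcd.2.2⟩
    obtain ⟨i, hi, h⟩ := exists_memCommonPrefix hP j (I := {s'}) (by simp)
      (B := fun _ => l₁ ++ m :: r₂) (fun _ _ => hchain)
      (fun i hi a ha => by
        rw [Finset.mem_singleton.1 hi]
        refine hP.tail_of_isPrefix (hl'.trans hd) a ?_
        cases l₁ <;> simp_all)
      (fun i hi i' hi' hne => by simp_all) (fun i _ i' hi' a ha hai' => by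
        have hne : i' ≠ s' := by simpa using hi'
        rcases List.mem_append.1 ha with ha | ha
        · exact hne (hP.eq_of_mem hai' (hdP a (hl₁.subset ha) i' hai').mem_right)
        · have ha' : a ∈ d' ++ [x'] := by rw [hr]; simp [List.mem_cons.1 ha]
          rcases List.mem_append.1 ha' with ha' | ha'
          · obtain ⟨t, ht⟩ := hd'
            have hnd := nodup_of_isChain (hP.isChain s k')
            have hpre := hdP' a ha' i' hai'
            rw [hr, List.append_assoc, List.cons_append] at ht
            refine hmk (hpv m ?_)
            rw [← ht] at hpre hnd ⊢
            have := hpre.concat_isPrefix hnd (List.mem_append_left t ha)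
            exact ⟨r₁ ++ [m], by simp, this, by simp⟩
          · rw [List.mem_singleton.1 ha'] at hai'
            exact hne (hP.eq_of_mem hai' hs'))
    have := (h s' x' (List.mem_append_right _ hxr) hs').concat_isPrefix
      (nodup_of_isChain hchain) hxr
    rw [Finset.mem_singleton.1 hi] at this
    exact hmk' (hpu m ⟨l₁ ++ [m], hl'.trans hd, this, by simp⟩)
  · push Not at hmeet
    obtain ⟨i, hi, h⟩ := exists_memCommonPrefix hP j (I := {s', s}) (by simp)
      (B := fun i => if i = s' then d ++ [x] else d' ++ [x'])
      (fun i _ => by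
        split_ifs
        exacts [(hP.isChain _ _).prefix hd, (hP.isChain _ _).prefix hd'])
      (fun i hi => by
        split_ifs with h
        · rw [h]; exact hP.tail_of_isPrefix hd
        · rw [show i = s by simpa [h] using hi]; exact hP.tail_of_isPrefix hd')
      (fun i hi i' hi' hne a ha ha' => by
        split_ifs at ha ha' with h₁ h₂ h₂
        · exact hne (h₁.trans h₂.symm)
        · exact hmeet a ha ha'
        · exact hmeet a ha' ha
        · simp_all)
      (fun i hi i' hi' a ha => by
        rw [show i' = w by have := hcases i'; simp_all]
        split_ifs at ha
        exacts [hu a (hd.subset ha), hv a (hd'.subset ha)])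
    rcases Finset.mem_insert.1 hi with rfl | hi
    · simp only [if_true] at h
      exact hx ((h s x (by simp) hs).mono hd)
    · obtain rfl := Finset.mem_singleton.1 hi
      simp only [huv.symm, if_false] at h
      exact hx' ((h s' x' (by simp) hs').mono hd')

theorem IsStableSystem.exists_order (hP : N.IsStableSystem P) (q : Fin 3) :
    ∃ e ∈ orders, (∀ i i', (∃ a ∈ P i (q + 1), a ∈ P i' (q + 2)) → rank e i ≤ rank e i') ∧
      ∀ i, rank e i ≠ 1 → ∀ a ∈ P i (q + 1), a ∈ P i (q + 2) →
        List.MemCommonPrefix (P i (q + 1)) (P i (q + 2)) a := by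
  refine RoutingTable.exists_order (fun i i' => ∃ a ∈ P i (q + 1), a ∈ P i' (q + 2)) _ ?_ ?_
  · intro I hI h
    obtain ⟨i, hi, hi'⟩ := exists_memCommonPrefix hP (q + 1) hI (B := fun i => P i (q + 2))
      (fun i _ => hP.isChain i _) (fun i _ => hP.tail_of_isPrefix List.prefix_rfl)
      (fun i _ i' _ hne a ha ha' => hne (hP.eq_of_mem ha ha'))
      (fun i hi i' hi' a ha ha' => h i hi i' hi' ⟨a, ha', ha⟩)
    exact ⟨i, hi, fun i' ⟨a, ha, ha'⟩ => hP.eq_of_mem ha (hi' i' a ha' ha).mem_right,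
      fun a ha ha' => (hi' i a ha' ha).symm⟩
  · intro I hI h
    obtain ⟨i, hi, hi'⟩ := exists_memCommonPrefix hP (q + 2) hI (B := fun i => P i (q + 1))
      (fun i _ => hP.isChain i _) (fun i _ => hP.tail_of_isPrefix List.prefix_rfl)
      (fun i _ i' _ hne a ha ha' => hne (hP.eq_of_mem ha ha'))
      (fun i hi i' hi' a ha ha' => h i hi i' hi' ⟨a, ha, ha'⟩)
    exact ⟨i, hi, fun i' ⟨a, ha, ha'⟩ => hP.eq_of_mem ha' (hi' i' a ha ha').mem_right,
      fun a ha ha' => hi' i a ha ha'⟩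

theorem IsStableSystem.mayMeet (hP : N.IsStableSystem P) {o : Fin 3 → Fin 3 × Fin 3}
    (ho : ∀ q i i', (∃ a ∈ P i (q + 1), a ∈ P i' (q + 2)) → rank (o q) i ≤ rank (o q) i')
    {i j i' j' : Fin 3} {a : N.A} (h : a ∈ P i j) (h' : a ∈ P i' j') : MayMeet o i j i' j' := by
  unfold MayMeet
  have hj : ∀ j : Fin 3, j + 2 + 1 = j ∧ j + 2 + 2 = j + 1 := by decide
  have hjj : ∀ j j' : Fin 3, j' ≠ j + 1 → j ≠ j' + 1 → j = j' := by decide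
  split_ifs with h₁ h₂
  · refine ho _ _ _ ⟨a, ?_, ?_⟩
    · rwa [(hj j).1]
    · rwa [(hj j).2, ← h₁]
  · refine ho _ _ _ ⟨a, ?_, ?_⟩
    · rwa [(hj j').1]
    · rwa [(hj j').2, ← h₂]
  · obtain rfl := hjj j j' h₁ h₂
    exact hP.eq_of_mem h h'

theorem exists_not_missesOnly (hP : N.IsStableSystem P) {o : Fin 3 → Fin 3 × Fin 3}
    (ho : ∀ q i i', (∃ a ∈ P i (q + 1), a ∈ P i' (q + 2)) → rank (o q) i ≤ rank (o q) i')
    (ho' : ∀ q i, rank (o q) i ≠ 1 → ∀ a ∈ P i (q + 1), a ∈ P i (q + 2) →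
      List.MemCommonPrefix (P i (q + 1)) (P i (q + 2)) a) :
    ∀ cl ∈ nestedClauses o ++ exchangeClauses o, ∃ b ∈ cl, ¬ MissesOnly P b.1 b.2 := by
  have hpre : ∀ q j j' i, j ≠ j' → j ≠ q → j' ≠ q → rank (o q) i ≠ 1 → ∀ a ∈ P i j, a ∈ P i j' →
      List.MemCommonPrefix (P i j) (P i j') a := by
    intro q j j' i h₁ h₂ h₃ hr a ha ha'
    have hq : ∀ q j j' : Fin 3, j ≠ j' → j ≠ q → j' ≠ q →
        (j = q + 1 ∧ j' = q + 2) ∨ (j' = q + 1 ∧ j = q + 2) := by decide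
    rcases hq q j j' h₁ h₂ h₃ with ⟨rfl, rfl⟩ | ⟨rfl, rfl⟩
    · exact ho' q i hr a ha ha'
    · exact (ho' q i hr a ha' ha).symm
  have hsucc : ∀ q : Fin 3, q ≠ q + 1 ∧ q + 2 ≠ q ∧ q + 2 ≠ q + 1 := by decide
  intro cl hcl
  rcases List.mem_append.1 hcl with hcl | hcl
  · simp only [nestedClauses, List.mem_flatMap, List.mem_filterMap] at hcl
    obtain ⟨i, -, q, -, h⟩ := hcl
    split_ifs at h with hr
    cases h
    obtain ⟨h₁, h₂, h₃⟩ := hsucc q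
    rcases not_missesOnly_or_of_nested h₁ h₂ h₃ (hpre (q + 1) _ _ i h₂ h₃ h₁ hr.2)
      (hpre q _ _ i h₃ h₂ h₁.symm hr.1) with h | h
    exacts [⟨(i, q), by simp, h⟩, ⟨(i, q + 1), by simp, h⟩]
  · simp only [exchangeClauses, List.mem_flatMap, List.mem_filterMap] at hcl
    obtain ⟨⟨j, k, k'⟩, hj, ⟨u, v, w⟩, hu, h⟩ := hcl
    have hne : ∀ t ∈ arrangements, t.1 ≠ t.2.1 ∧ t.1 ≠ t.2.2 ∧ t.2.1 ≠ t.2.2 := by decide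
    obtain ⟨hjk, hjk', hkk'⟩ := hne _ hj
    obtain ⟨huv, huw, hvw⟩ := hne _ hu
    simp only at h hjk hjk' hkk' huv huw hvw
    split_ifs at h with hr
    cases h
    obtain ⟨h₁, h₂, h₃, h₄⟩ := hr
    rcases not_missesOnly_or_of_exchange hP hjk hjk' hkk' huv huw hvw
      (fun a ha ha' => h₁ (hP.mayMeet ho ha ha')) (fun a ha ha' => h₂ (hP.mayMeet ho ha ha'))
      (hpre k _ _ u hjk' hjk hkk'.symm h₃) (hpre j _ _ v hkk'.symm hjk'.symm hjk.symm h₄)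
      with h | h | h | h
    exacts [⟨(u, k), by simp, h⟩, ⟨(v, j), by simp, h⟩, ⟨(u, k'), by simp, h⟩,
      ⟨(v, k), by simp, h⟩]

/-- The source whose path to the sink `j` contains the arc `a`. -/
noncomputable def sourceAt (P : Fin 3 → Fin 3 → List N.A) (a : N.A) (j : Fin 3) :
    Option (Fin 3) :=
  open Classical in if h : ∃ i, a ∈ P i j then some h.choose else none

theorem mem_of_sourceAt {a : N.A} {i j : Fin 3} (h : sourceAt P a j = some i) : a ∈ P i j := by
  unfold sourceAt at h
  split_ifs at h with h'
  cases h
  exact h'.choose_spec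

theorem IsStableSystem.sourceAt_eq (hP : N.IsStableSystem P) {a : N.A} {i j : Fin 3} :
    sourceAt P a j = some i ↔ a ∈ P i j := by
  refine ⟨mem_of_sourceAt, fun h => ?_⟩
  have h' : ∃ i, a ∈ P i j := ⟨i, h⟩
  simp only [sourceAt, h', dif_pos, Option.some_inj]
  exact hP.eq_of_mem h'.choose_spec h

theorem IsStableSystem.compatible (hP : N.IsStableSystem P) {o : Fin 3 → Fin 3 × Fin 3}
    (ho : ∀ q i i', (∃ a ∈ P i (q + 1), a ∈ P i' (q + 2)) → rank (o q) i ≤ rank (o q) i')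
    {m : List (Fin 3 × Fin 3)} (hm : ∀ b ∈ m, ¬ MissesOnly P b.1 b.2) (a : N.A) (q : Fin 3) :
    Compatible o m q (sourceAt P a (q + 1)) (sourceAt P a (q + 2)) (sourceAt P a q) = true := by
  unfold Compatible
  split
  · rename_i i i' hi hi'
    rw [hP.sourceAt_eq] at hi hi'
    rw [Bool.and_eq_true, decide_eq_true_iff]
    refine ⟨ho q i i' ⟨a, hi, hi'⟩, ?_⟩
    simp only [Bool.not_eq_true', Bool.and_eq_false_iff, decide_eq_false_iff_not]
    by_contra! h
    obtain ⟨⟨rfl, hq⟩, hmem⟩ := h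
    rw [Ne, hP.sourceAt_eq] at hq
    refine hm _ hmem ⟨a, fun j => ?_⟩
    have hj : ∀ q j : Fin 3, j = q ∨ (j = q + 1 ∧ j ≠ q) ∨ (j = q + 2 ∧ j ≠ q) := by decide
    rcases hj q j with rfl | ⟨rfl, h⟩ | ⟨rfl, h⟩ <;> simp [*]
  · rfl

theorem IsStableSystem.mem_patterns (hP : N.IsStableSystem P) {o : Fin 3 → Fin 3 × Fin 3}
    (ho : ∀ q i i', (∃ a ∈ P i (q + 1), a ∈ P i' (q + 2)) → rank (o q) i ≤ rank (o q) i')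
    {m : List (Fin 3 × Fin 3)} (hm : ∀ b ∈ m, ¬ MissesOnly P b.1 b.2) (a : N.A) :
    (sourceAt P a 0, sourceAt P a 1, sourceAt P a 2) ∈ patterns o m := by
  have h := hP.compatible ho hm a
  refine List.mem_filter.2 ⟨?_, ?_⟩
  · exact List.pair_mem_product.2
      ⟨mem_options _, List.pair_mem_product.2 ⟨mem_options _, mem_options _⟩⟩
  · simp only [Bool.and_eq_true]
    exact ⟨⟨h 2, h 0⟩, h 1⟩

theorem IsStableSystem.sum_mul_unitFlow (hP : N.IsStableSystem P) (c : Fin 3 → Fin 3 → ℤ)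
    (a : N.A) (j : Fin 3) :
    ∑ i, (c i j / 24 : ℝ) * N.unitFlow (P i j) a = (term c (sourceAt P a j) j : ℝ) / 24 := by
  cases h : sourceAt P a j with
  | none =>
    have h' : ∀ i, a ∉ P i j := fun i hi => by simp [hP.sourceAt_eq.2 hi] at h
    simp [term, unitFlow, h']
  | some i =>
    rw [Finset.sum_eq_single i]
    · simp [term, unitFlow, mem_of_sourceAt h]
    · intro i' _ hne
      have : a ∉ P i' j := fun h' => hne (hP.eq_of_mem h' (mem_of_sourceAt h))
      simp [unitFlow, this]
    · simp

/-- Some tabulated coefficients load no arc by more than its capacity. -/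
theorem IsStableSystem.exists_coeff (hP : N.IsStableSystem P) :
    ∃ T ∈ table, ∃ e ∈ orders, ∀ a : N.A,
      load (coeff T e) (sourceAt P a 0) (sourceAt P a 1) (sourceAt P a 2) ≤ 24 := by
  choose o ho ho₁ ho₂ using hP.exists_order
  obtain ⟨m, hm, hmP⟩ := exists_solvable (E := fun b => ¬ MissesOnly P b.1 b.2)
    (solvableByCases_of_mem_orders ho) (exists_not_missesOnly hP ho₁ ho₂)
    fun b hb => absurd hb List.not_mem_nil
  obtain ⟨T, hT, e, he, h⟩ := exists_coeff_of_solvable hm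
  exact ⟨T, hT, e, he, fun a => h _ _ _ (hP.mem_patterns ho₁ hmP a)⟩

/-- The excess of a combination of unit flows whose coefficients have prescribed row and column
sums. -/
theorem IsStrongSystem.excess_sum_unitFlow (hP : N.IsStrongSystem P) {c : Fin 3 → Fin 3 → ℝ}
    {l : Fin 3} (hrow : ∀ i, ∑ j, c i j = if i = l then 1 else 0)
    (hcol : ∀ j, ∑ i, c i j = if j = l then 1 else 0) (w : N.V) :
    N.excess (fun a => ∑ i, ∑ j, c i j * N.unitFlow (P i j) a) w =
      (if N.snk l = w then 1 else 0) - if N.src l = w then 1 else 0 := by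
  have h : N.excess (fun a => ∑ i, ∑ j, c i j * N.unitFlow (P i j) a) w =
      ∑ i, ∑ j, c i j * N.excess (N.unitFlow (P i j)) w := by
    have := excess_sum (N := N) Finset.univ (fun _ => 1)
      (fun i a => ∑ j, c i j * N.unitFlow (P i j) a) w
    simp only [one_mul] at this
    rw [this]
    exact Finset.sum_congr rfl fun i _ => excess_sum _ _ _ _
  rw [h]
  simp only [fun i j => excess_unitFlow (hP.1 i j) w, mul_sub, Finset.sum_sub_distrib]
  congr 1
  · rw [Finset.sum_comm]
    simp only [← Finset.sum_mul, hcol, ite_mul, one_mul, zero_mul, Finset.sum_ite_eq',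
      Finset.mem_univ, if_true]
  · simp only [← Finset.sum_mul, hrow, ite_mul, one_mul, zero_mul, Finset.sum_ite_eq',
      Finset.mem_univ, if_true]

end KPairNetwork

/-- Theorem 8 of the paper: every stable 3-pair network
has a linear routing solution: coefficients `c` such that the multi-flow
`f l = Σ_{i,j} c l i j • f_{i,j}` is a multi-flow of rate `(1,1,1)` and is
feasible. -/
theorem statement11 (N : KPairNetwork 3) (P : Fin 3 → Fin 3 → List N.A)
    (hP : N.IsStableSystem P) :
    ∃ (c : Fin 3 → Fin 3 → Fin 3 → ℝ) (f : Fin 3 → N.A → ℝ),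
      (∀ l a, f l a = ∑ i : Fin 3, ∑ j : Fin 3, c l i j * N.unitFlow (P i j) a) ∧
      (∀ l, N.IsFlow (N.src l) (N.snk l) (f l)) ∧
      (∀ l, N.excess (f l) (N.snk l) = 1) ∧
      ∀ a : N.A, ∑ l : Fin 3, |f l a| ≤ 1 := by
  obtain ⟨T, hT, e, he, hload⟩ := hP.exists_coeff
  obtain ⟨hrow, hcol⟩ := RoutingTable.sum_coeff T hT e he
  have hexcess := fun l => hP.1.excess_sum_unitFlow
    (c := fun i j => (RoutingTable.coeff T e l i j : ℝ) / 24) (l := l)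
    (fun i => by
      rw [← Finset.sum_div, ← Int.cast_sum, hrow]
      split_ifs <;> norm_num)
    (fun j => by
      rw [← Finset.sum_div, ← Int.cast_sum, hcol]
      split_ifs <;> norm_num)
  refine ⟨fun l i j => (RoutingTable.coeff T e l i j : ℝ) / 24, _, fun l a => rfl,
    fun l w hs ht => ?_, fun l => ?_, fun a => ?_⟩
  · refine (hexcess l w).trans ?_
    simp [hs.symm, ht.symm]
  · refine (hexcess l _).trans ?_
    simp [KPairNetwork.src_ne_snk hP.1]
  · have hsum : ∀ l, ∑ i, ∑ j, (RoutingTable.coeff T e l i j : ℝ) / 24 * N.unitFlow (P i j) a =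
        (RoutingTable.term (RoutingTable.coeff T e l) (KPairNetwork.sourceAt P a 0) 0 +
          RoutingTable.term (RoutingTable.coeff T e l) (KPairNetwork.sourceAt P a 1) 1 +
          RoutingTable.term (RoutingTable.coeff T e l) (KPairNetwork.sourceAt P a 2) 2 : ℤ) /
          (24 : ℝ) := by
      intro l
      rw [Finset.sum_comm]
      simp only [hP.sum_mul_unitFlow]
      rw [Fin.sum_univ_three]
      push_cast
      ring
    have h : (RoutingTable.load (RoutingTable.coeff T e) (KPairNetwork.sourceAt P a 0)
        (KPairNetwork.sourceAt P a 1) (KPairNetwork.sourceAt P a 2) : ℝ) ≤ 24 := by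
      exact_mod_cast hload a
    simp only [RoutingTable.load, Nat.cast_add, Nat.cast_natAbs, Int.cast_abs] at h
    simp only [hsum, abs_div, abs_of_pos (show (0 : ℝ) < 24 by norm_num)]
    rw [Fin.sum_univ_three]
    linarith
end
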